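/- Let X be a Peano space whose maximal cyclic subsets are compact surfaces, and let (C_n) be a sequence of subcontinua of X each of which intersects every maximal cyclic subset of X in at most one point. If (C_n) converges in the Hausdorff distance to a subset C ⊂ X, then C is a subcontinuum which intersects every maximal cyclic subset of X in at most one point. -/

import Mathlib

open Filter Topology Metric Set GromovHausdorff
open scoped ENNReal unitInterval

noncomputable section

/-! ## Model spaces -/

/-- The closed upper half plane in `ℝ × ℝ` (used for topological charts). -/
def HalfPlane : Set (ℝ × ℝ) := {p | 0 ≤ p.2}

/-- The closed upper half plane in the Euclidean plane (used for metric charts). -/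
def EHalfPlane : Set (EuclideanSpace ℝ (Fin 2)) := {p | 0 ≤ p 1}

/-- The unit circle (the 1-sphere). -/
def Circle1 : Set (EuclideanSpace ℝ (Fin 2)) := Metric.sphere 0 1

/-- The 2-sphere. -/
def Sphere2 : Set (EuclideanSpace ℝ (Fin 3)) := Metric.sphere 0 1

/-- The closed 2-disc. -/
def Disc2 : Set (EuclideanSpace ℝ (Fin 2)) := Metric.closedBall 0 1

/-- The relation on the unit square generating the Möbius identification
`(0, y) ∼ (1, 1 - y)`. -/
def mobiusRel (p q : I × I) : Prop :=
  ((p.1 : ℝ) = 0 ∧ (q.1 : ℝ) = 1 ∧ (p.2 : ℝ) = 1 - (q.2 : ℝ)) ∨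
  ((p.1 : ℝ) = 1 ∧ (q.1 : ℝ) = 0 ∧ (p.2 : ℝ) = 1 - (q.2 : ℝ))

/-- The Möbius band, as a quotient of the unit square. -/
def MobiusBand : Type := Quot mobiusRel

instance : TopologicalSpace MobiusBand :=
  inferInstanceAs (TopologicalSpace (Quot mobiusRel))

/-! ## Surfaces -/

/-- A topological 2-manifold with (possibly empty) boundary: every point has an open
neighborhood homeomorphic to an open subset of the closed half plane. -/
def IsSurface (X : Type*) [TopologicalSpace X] : Prop :=
  ∀ x : X, ∃ (U : Set X) (V : Set HalfPlane),
    IsOpen U ∧ x ∈ U ∧ IsOpen V ∧ Nonempty (↥U ≃ₜ ↥V)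

/-- A compact surface: a compact connected (Hausdorff) topological 2-manifold with
possibly empty boundary. -/
def IsCompactSurface (X : Type*) [TopologicalSpace X] : Prop :=
  CompactSpace X ∧ ConnectedSpace X ∧ T2Space X ∧ IsSurface X

/-- The (manifold) boundary of a surface: the set of points having no open neighborhood
homeomorphic to an open subset of the plane. -/
def surfaceBoundary (X : Type*) [TopologicalSpace X] : Set X :=
  {x | ¬ ∃ (U : Set X) (V : Set (ℝ × ℝ)), IsOpen U ∧ x ∈ U ∧ IsOpen V ∧ Nonempty (↥U ≃ₜ ↥V)}

/-- The set of boundary components of a surface, i.e. the connected components of the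
boundary. -/
def surfaceBoundaryComponents (X : Type*) [TopologicalSpace X] : Set (Set X) :=
  {b | ∃ x ∈ surfaceBoundary X, b = connectedComponentIn (surfaceBoundary X) x}

/-- A surface is orientable iff it contains no subset homeomorphic to the Möbius band. -/
def SurfOrientable (X : Type*) [TopologicalSpace X] : Prop :=
  ¬ ∃ A : Set X, Nonempty (↥A ≃ₜ MobiusBand)

/-- The free rank of the first homology (the abelianized fundamental group). -/
noncomputable def h1Rank (X : Type*) [TopologicalSpace X] : ℕ :=
  ⨆ x : X, (Module.rank ℤ (Additive (Abelianization (FundamentalGroup X x)))).toNat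

open Classical in
/-- The connectivity number of a compact surface `S`, i.e. `2 - χ(S)`.  By the
classification of compact surfaces this equals the free rank of the first homology,
plus one unless the surface is closed and orientable. -/
noncomputable def connNum (X : Type*) [TopologicalSpace X] : ℕ :=
  h1Rank X + (if surfaceBoundary X = ∅ ∧ SurfOrientable X then 0 else 1)

/-- The reduced connectivity number: the connectivity number minus the number of
boundary components. -/
noncomputable def redConnNum (X : Type*) [TopologicalSpace X] : ℤ :=
  (connNum X : ℤ) - ((surfaceBoundaryComponents X).ncard : ℤ)

/-! ## Length and geodesic spaces -/

/-- The length of a path, as the total variation of the parametrization. -/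
noncomputable def pathLength {X : Type*} [MetricSpace X] {x y : X} (γ : Path x y) : ℝ≥0∞ :=
  eVariationOn (fun t => γ t) Set.univ

/-- A metric space is a length space if the distance between any two points is the
infimum of the lengths of paths joining them. -/
def IsLengthSpace (X : Type*) [MetricSpace X] : Prop :=
  ∀ x y : X, edist x y = ⨅ γ : Path x y, pathLength γ

/-- A metric space is geodesic if any two points are joined by a path whose length
realizes the distance. -/
def IsGeodesicSpace (X : Type*) [MetricSpace X] : Prop :=
  ∀ x y : X, ∃ γ : Path x y, pathLength γ = edist x y

/-! ## Peano spaces, Jordan curves and cyclic elements -/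

/-- A Peano space: a compact connected locally connected metric space. -/
def IsPeano (X : Type*) [MetricSpace X] : Prop :=
  CompactSpace X ∧ ConnectedSpace X ∧ LocallyConnectedSpace X

/-- A Jordan curve: a subset homeomorphic to the 1-sphere. -/
def IsJordanCurve {X : Type*} [TopologicalSpace X] (J : Set X) : Prop :=
  Nonempty (↥J ≃ₜ ↥Circle1)

/-- A set is cyclicly connected if every pair of distinct points of it lies on a common
Jordan curve contained in it. -/
def CycliclyConnected {X : Type*} [TopologicalSpace X] (A : Set X) : Prop :=
  ∀ x ∈ A, ∀ y ∈ A, x ≠ y → ∃ J : Set X, J ⊆ A ∧ IsJordanCurve J ∧ x ∈ J ∧ y ∈ J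

/-- A maximal cyclic subset: a nondegenerate cyclicly connected subset which is not a
proper subset of any cyclicly connected subset. -/
def IsMaximalCyclic {X : Type*} [TopologicalSpace X] (A : Set X) : Prop :=
  A.Nontrivial ∧ CycliclyConnected A ∧ ∀ B : Set X, CycliclyConnected B → A ⊆ B → A = B

/-- A subcontinuum: a compact connected (hence nonempty) subset. -/
def IsSubcontinuum {X : Type*} [TopologicalSpace X] (C : Set X) : Prop :=
  IsCompact C ∧ IsConnected C

/-- `b` is a boundary component of the subset `T` (viewed as a subspace). -/
def IsBoundaryComponentOf {X : Type*} [TopologicalSpace X] (T b : Set X) : Prop :=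
  ∃ b' ∈ surfaceBoundaryComponents ↥T, b = Subtype.val '' b'

/-- An admissible subcontinuum: it meets every maximal cyclic subset `T` in at most a
point or in a boundary component of `T`. -/
def IsAdmissible {X : Type*} [TopologicalSpace X] (C : Set X) : Prop :=
  IsSubcontinuum C ∧
    ∀ T : Set X, IsMaximalCyclic T →
      ((T ∩ C).Subsingleton ∨ IsBoundaryComponentOf T (T ∩ C))

/-- A 1-cactoid: a Peano space all of whose maximal cyclic subsets are homeomorphic to
the 1-sphere. -/
def IsOneCactoid (X : Type*) [MetricSpace X] : Prop :=
  IsPeano X ∧ ∀ T : Set X, IsMaximalCyclic T → Nonempty (↥T ≃ₜ ↥Circle1)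

/-- A subset homeomorphic to the 2-sphere or the closed 2-disc. -/
def SphereOrDisc {X : Type*} [TopologicalSpace X] (T : Set X) : Prop :=
  Nonempty (↥T ≃ₜ ↥Sphere2) ∨ Nonempty (↥T ≃ₜ ↥Disc2)

/-! ## Generalized cactoids -/

/-- A generalized cactoid. -/
def IsGeneralizedCactoid (X : Type*) [MetricSpace X] : Prop :=
  IsPeano X ∧ (∀ T : Set X, IsMaximalCyclic T → IsCompactSurface ↥T) ∧
  {T : Set X | IsMaximalCyclic T ∧ ¬ SphereOrDisc T}.Finite ∧
  ∃ (n : ℕ) (C : Fin n → Set X),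
    (∀ i, IsAdmissible (C i)) ∧ (Pairwise fun i j => Disjoint (C i) (C j)) ∧
    ∀ T b : Set X, IsMaximalCyclic T → IsBoundaryComponentOf T b → b ⊆ ⋃ i, C i

/-- A pre-boundary consisting of `n` disjoint admissible subcontinua, each containing a
boundary component of some maximal cyclic subset, which together cover all boundary
components of all maximal cyclic subsets. -/
def IsPreBoundaryOfSize {X : Type*} [TopologicalSpace X] (n : ℕ) (P : Set X) : Prop :=
  ∃ C : Fin n → Set X,
    (∀ i, IsAdmissible (C i)) ∧ (Pairwise fun i j => Disjoint (C i) (C j)) ∧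
    (∀ i, ∃ T b : Set X, IsMaximalCyclic T ∧ IsBoundaryComponentOf T b ∧ b ⊆ C i) ∧
    (∀ T b : Set X, IsMaximalCyclic T → IsBoundaryComponentOf T b → b ⊆ ⋃ i, C i) ∧
    P = ⋃ i, C i

def IsPreBoundary {X : Type*} [TopologicalSpace X] (P : Set X) : Prop :=
  ∃ n, IsPreBoundaryOfSize n P

/-- A minimal pre-boundary: one with the minimal possible number of pieces. -/
def IsMinimalPreBoundary {X : Type*} [TopologicalSpace X] (P : Set X) : Prop :=
  ∃ n, IsPreBoundaryOfSize n P ∧ ∀ (m : ℕ) (Q : Set X), IsPreBoundaryOfSize m Q → n ≤ m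

/-- The boundary of a generalized cactoid: the union of all minimal pre-boundaries. -/
def cactoidBoundary (X : Type*) [TopologicalSpace X] : Set X :=
  ⋃₀ {P : Set X | IsMinimalPreBoundary P}

/-- The boundary components of a generalized cactoid: the connected components of its
boundary. -/
def cactoidBoundaryComponents (X : Type*) [TopologicalSpace X] : Set (Set X) :=
  {b | ∃ x ∈ cactoidBoundary X, b = connectedComponentIn (cactoidBoundary X) x}

/-- The connectivity number of a generalized cactoid: the sum of the reduced
connectivity numbers of its maximal cyclic subsets plus the number of its boundary
components. -/
noncomputable def cactoidConnNum (X : Type*) [TopologicalSpace X] : ℤ :=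
  (∑ᶠ T ∈ {T : Set X | IsMaximalCyclic T}, redConnNum ↥T) +
    ((cactoidBoundaryComponents X).ncard : ℤ)

/-! ## Bundled spaces -/

structure BundledMet where
  carrier : Type
  [str : MetricSpace carrier]

attribute [instance] BundledMet.str

structure BundledTop where
  carrier : Type
  [str : TopologicalSpace carrier]

attribute [instance] BundledTop.str

/-! ## Metric two-point identifications -/

/-- `p : A → B` is (the projection of) a metric 2-point identification: it glues exactly
two distinct points `x₁, x₂` of `A` and carries the corresponding quotient metric. -/
def IsTwoPointIdentification {A B : Type*} [MetricSpace A] [MetricSpace B] (p : A → B) : Prop :=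
  Function.Surjective p ∧ ∃ x₁ x₂ : A, x₁ ≠ x₂ ∧
    (∀ a b : A, p a = p b ↔ (a = b ∨ (a = x₁ ∧ b = x₂) ∨ (a = x₂ ∧ b = x₁))) ∧
    ∀ a b : A, dist (p a) (p b) =
      min (dist a b) (min (dist a x₁ + dist x₂ b) (dist a x₂ + dist x₁ b))

/-- `Y` is obtained from `X` by a successive application of `k` metric 2-point
identifications, exactly `k₀` of which are boundary identifications with respect to the
subset `B ⊆ X`. -/
def ObtainedByIdentifications (X : Type) [MetricSpace X] (B : Set X) (k k0 : ℕ)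
    (Y : Type) [MetricSpace Y] : Prop :=
  ∃ (Z : ℕ → BundledMet) (p : ∀ i : ℕ, (Z i).carrier → (Z (i + 1)).carrier)
    (e : X ≃ᵢ (Z 0).carrier) (f : (Z k).carrier ≃ᵢ Y) (q : ∀ i : ℕ, X → (Z i).carrier),
    (∀ i, i < k → IsTwoPointIdentification (p i)) ∧
    (∀ x, q 0 x = e x) ∧ (∀ i x, q (i + 1) x = p i (q i x)) ∧
    {i : ℕ | i < k ∧ ∃ a b : (Z i).carrier,
        a ∈ q i '' B ∧ b ∈ q i '' B ∧ a ≠ b ∧ p i a = p i b}.ncard = k0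

/-! ## Gromov–Hausdorff sequences of surfaces -/

/-- A sequence of (isometry classes of) compact length surfaces with connectivity
number `c`. -/
def IsSurfaceGHSeq (c : ℕ) (K : ℕ → GHSpace) : Prop :=
  ∀ n, IsCompactSurface (K n).Rep ∧ IsLengthSpace (K n).Rep ∧ connNum (K n).Rep = c

/-- The structural description of the limit spaces in the Main Theorem: `X` is obtained
from a geodesic generalized cactoid `Y` by `k` successive metric 2-point
identifications, `k₀` of them boundary identifications, where the connectivity number
of `Y` is at most `c + k₀ - 2k`. -/
def MainThmRHS (c : ℕ) (X : Type) [MetricSpace X] : Prop :=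
  ∃ (k k0 : ℕ) (Y : BundledMet),
    IsGeneralizedCactoid Y.carrier ∧ IsGeodesicSpace Y.carrier ∧
    ObtainedByIdentifications Y.carrier (cactoidBoundary Y.carrier) k k0 X ∧
    cactoidConnNum Y.carrier ≤ (c : ℤ) + (k0 : ℤ) - 2 * (k : ℤ)

/-! ## Covering dimension -/

/-- `X` has covering dimension at most `n`: every open cover admits an open refinement
of order at most `n + 1`. -/
def CoveringDimLE (X : Type*) [TopologicalSpace X] (n : ℕ) : Prop :=
  ∀ U : Set (Set X), (∀ u ∈ U, IsOpen u) → ⋃₀ U = Set.univ →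
    ∃ V : Set (Set X), (∀ v ∈ V, IsOpen v) ∧ ⋃₀ V = Set.univ ∧
      (∀ v ∈ V, ∃ u ∈ U, v ⊆ u) ∧
      ∀ x : X, {v | v ∈ V ∧ x ∈ v}.encard ≤ (n : ℕ∞) + 1

/-! ## Curves in surfaces -/

/-- A continuous map from the circle is nullhomotopic if it is homotopic to a constant. -/
def IsNullhomotopic {X : Type*} [TopologicalSpace X] (f : C(↥Circle1, X)) : Prop :=
  ∃ y : X, f.Homotopic (ContinuousMap.const _ y)

/-- A contractible Jordan curve. -/
def IsContractibleJordanCurve {X : Type*} [TopologicalSpace X] (J : Set X) : Prop :=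
  IsJordanCurve J ∧
    ∀ f : C(↥Circle1, X), Function.Injective f → Set.range f = J → IsNullhomotopic f

/-- A non-contractible Jordan curve. -/
def IsNonContractibleJordanCurve {X : Type*} [TopologicalSpace X] (J : Set X) : Prop :=
  IsJordanCurve J ∧
    ∀ f : C(↥Circle1, X), Function.Injective f → Set.range f = J → ¬ IsNullhomotopic f

/-- A simple arc in a surface: an injective path whose endpoints lie on the boundary and
whose interior does not. -/
def IsSimpleArc {X : Type*} [TopologicalSpace X] (γ : C(I, X)) : Prop :=
  Function.Injective γ ∧ γ 0 ∈ surfaceBoundary X ∧ γ 1 ∈ surfaceBoundary X ∧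
    ∀ t : I, t ≠ 0 → t ≠ 1 → γ t ∉ surfaceBoundary X

/-- A subset separates the space if its complement is disconnected. -/
def SeparatesSpace {X : Type*} [TopologicalSpace X] (A : Set X) : Prop :=
  ¬ IsPreconnected Aᶜ

/-- The arc `γ` forms a contractible Jordan curve together with a subarc of some
boundary component. -/
def FormsContractibleJordanWithBoundary {X : Type*} [TopologicalSpace X]
    (γ : C(I, X)) : Prop :=
  ∃ β : C(I, X), Function.Injective β ∧ Set.range β ⊆ surfaceBoundary X ∧
    β 0 = γ 0 ∧ β 1 = γ 1 ∧ IsContractibleJordanCurve (Set.range γ ∪ Set.range β)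

/-- `z` separates `x` and `y` inside the subset `A`: both lie in `A \ {z}` and no
connected subset of `A \ {z}` contains both. -/
def SeparatesIn {X : Type*} [TopologicalSpace X] (A : Set X) (z x y : X) : Prop :=
  x ∈ A \ {z} ∧ y ∈ A \ {z} ∧
    ∀ C : Set X, C ⊆ A \ {z} → IsPreconnected C → ¬ (x ∈ C ∧ y ∈ C)

/-! ## Metric doubles -/

/-- `D` together with the two canonical maps `ip, im : X → D` is the metric double of
`X` along the subset `B`. -/
structure IsMetricDouble (X : Type*) [MetricSpace X] (B : Set X) (D : Type*)
    [MetricSpace D] (ip im : X → D) : Prop where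
  isom_p : Isometry ip
  isom_m : Isometry im
  surj : Set.range ip ∪ Set.range im = Set.univ
  agree : ∀ z ∈ B, ip z = im z
  dist_mix : ∀ a b : X, dist (ip a) (im b) = ⨅ z : ↥B, (dist a (z : X) + dist (z : X) b)

/-- Regularity of a sequence of doubles: there is no sequence of non-contractible
Jordan curves in the doubles with vanishing diameters. -/
def RegularDoubleSeq (D : ℕ → Type) [∀ n, MetricSpace (D n)] : Prop :=
  ∀ J : ∀ n, Set (D n), (∀ n, IsNonContractibleJordanCurve (J n)) →
    0 < ⨅ n, Metric.diam (J n)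

/-- The copy `A^+` (or `A^-`) in the double limit corresponding to a subset `A` of the
limit `X`, via the isometric identification `j` of `X` with `X^+` (resp. `X^-`). -/
def plusCopy {Z D : Type*} {X : Set Z} {Xp : Set D} (j : ↥X → ↥Xp) (A : Set Z) :
    Set D :=
  (fun x => ((j x : ↥Xp) : D)) '' {x : ↥X | (x : Z) ∈ A}

/-! ## Riemannian and polyhedral surfaces -/

/-- The Riemannian length integrand `√(g_{γ(t)}(γ'(t), γ'(t)))`. -/
noncomputable def riemLengthIntegrand (g : (ℝ × ℝ) → (ℝ × ℝ) → (ℝ × ℝ) → ℝ)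
    (γ : ℝ → ℝ × ℝ) (t : ℝ) : ℝ :=
  Real.sqrt (g (γ t) (deriv γ t) (deriv γ t))

/-- A compact connected smooth Riemannian 2-manifold, as a metric space: a compact
length surface such that around every point there is a chart in which the length of
every C¹ curve is computed by a smooth positive definite symmetric bilinear metric. -/
def IsSmoothRiemannianSurface (X : Type*) [MetricSpace X] : Prop :=
  IsCompactSurface X ∧ IsLengthSpace X ∧
  ∀ x : X, ∃ (U : Set X) (V : Set (ℝ × ℝ)) (φ : X → ℝ × ℝ) (ψ : ℝ × ℝ → X)
      (g : (ℝ × ℝ) → (ℝ × ℝ) → (ℝ × ℝ) → ℝ),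
    IsOpen U ∧ x ∈ U ∧ (∃ V' : Set (ℝ × ℝ), IsOpen V' ∧ V = V' ∩ HalfPlane) ∧
    ContinuousOn φ U ∧ φ '' U = V ∧ ContinuousOn ψ V ∧
    (∀ y ∈ U, ψ (φ y) = y) ∧ (∀ v ∈ V, φ (ψ v) = v) ∧
    (∀ m : ℕ, ContDiffOn ℝ m
      (fun pq : (ℝ × ℝ) × (ℝ × ℝ) × (ℝ × ℝ) => g pq.1 pq.2.1 pq.2.2)
      (V ×ˢ ((Set.univ : Set (ℝ × ℝ)) ×ˢ (Set.univ : Set (ℝ × ℝ))))) ∧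
    (∀ p u v, g p u v = g p v u) ∧
    (∀ p (a : ℝ) u u' v, g p (a • u + u') v = a * g p u v + g p u' v) ∧
    (∀ p ∈ V, ∀ u : ℝ × ℝ, u ≠ 0 → 0 < g p u u) ∧
    ∀ (cur : ℝ → X) (a b : ℝ), a ≤ b → Set.MapsTo cur (Set.Icc a b) U →
      ContDiffOn ℝ 1 (φ ∘ cur) (Set.Icc a b) →
      eVariationOn cur (Set.Icc a b) =
        ENNReal.ofReal (∫ t in a..b, riemLengthIntegrand g (φ ∘ cur) t)

/-- A polyhedral surface: a compact length surface which is flat (locally isometric to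
a subset of the Euclidean half plane) away from finitely many singular points. -/
def IsPolyhedralSurface (X : Type*) [MetricSpace X] : Prop :=
  IsCompactSurface X ∧ IsLengthSpace X ∧
  ∃ F : Set X, F.Finite ∧ ∀ x : X, x ∉ F →
    ∃ (U : Set X) (W : Set (EuclideanSpace ℝ (Fin 2))),
      IsOpen U ∧ x ∈ U ∧ W ⊆ EHalfPlane ∧ Nonempty (↥U ≃ᵢ ↥W)

end

theorem IsPreconnected.exists_chain {X : Type*} [PseudoMetricSpace X] {S : Set X}
    (hS : IsPreconnected S) {δ : ℝ} (hδ : 0 < δ) {x y : X} (hx : x ∈ S) (hy : y ∈ S) :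
    ∃ (N : ℕ) (c : ℕ → X), c 0 = x ∧ (∀ j, N ≤ j → c j = y) ∧ (∀ j, c j ∈ S) ∧
      ∀ j, dist (c j) (c (j + 1)) < δ := by
  refine hS.induction₂ (fun x y => ∃ (N : ℕ) (c : ℕ → X), c 0 = x ∧ (∀ j, N ≤ j → c j = y) ∧
    (∀ j, c j ∈ S) ∧ ∀ j, dist (c j) (c (j + 1)) < δ) ?_ ?_ ?_ hx hy
  · intro x hx
    filter_upwards [self_mem_nhdsWithin, mem_nhdsWithin_of_mem_nhds (ball_mem_nhds x hδ)]
      with z hz hzx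
    refine ⟨1, fun j => if j = 0 then x else z, by simp, ?_, ?_, ?_⟩
    · intro j hj
      simp [Nat.one_le_iff_ne_zero.mp hj]
    · intro j
      dsimp only
      split_ifs <;> assumption
    · intro j
      by_cases h : j = 0
      · simpa [h, dist_comm] using hzx
      · simpa [h] using hδ
  · rintro x y z - - - ⟨N, c, c0, cN, cS, cd⟩ ⟨M, d, d0, dM, dS, dd⟩
    refine ⟨N + M, fun j => if j ≤ N then c j else d (j - N), by simp [c0], ?_, ?_, ?_⟩
    · intro j hj
      by_cases h : j ≤ N
      · have hM : M = 0 := by omega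
        have hj : j = N := by omega
        have : y = z := by rw [← d0, dM 0 (by omega)]
        simp [hj, cN, this]
      · simp [h, dM (j - N) (by omega)]
    · intro j
      dsimp only
      split_ifs
      exacts [cS _, dS _]
    · intro j
      rcases lt_trichotomy j N with h | h | h
      · simpa [h.le, Nat.succ_le_of_lt h] using cd j
      · subst h
        have := dd 0
        simpa [cN j le_rfl, d0] using this
      · have h1 : ¬ j ≤ N := by omega
        have h2 : ¬ j + 1 ≤ N := by omega
        have h3 : j + 1 - N = (j - N) + 1 := by omega
        simpa [h1, h2, h3] using dd (j - N)
  · rintro x y - - ⟨N, c, c0, cN, cS, cd⟩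
    refine ⟨N, fun j => c (N - j), by simp [cN], ?_, fun j => cS _, ?_⟩
    · intro j hj
      simp [Nat.sub_eq_zero_of_le hj, c0]
    · intro j
      by_cases h : N ≤ j
      · simpa [Nat.sub_eq_zero_of_le h, Nat.sub_eq_zero_of_le (h.trans j.le_succ)] using hδ
      · have h1 : N - j = (N - (j + 1)) + 1 := by omega
        simpa only [h1, dist_comm] using cd (N - (j + 1))

/-- A finite `δ`-chain from `x` to `y` can be refined, through small connected sets, to a finite
`δ'`-chain in which every old step is subdivided into the same number of new steps. -/
theorem exists_chain_refinement {X : Type*} [PseudoMetricSpace X] {δ ε δ' : ℝ} (hδ' : 0 < δ')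
    (hδ : ∀ x y : X, dist x y < δ → ∃ S, IsPreconnected S ∧ x ∈ S ∧ y ∈ S ∧ S ⊆ ball x ε)
    {x y : X} {L : ℕ} {f : ℕ → X} (f0 : f 0 = x) (fL : ∀ i, L ≤ i → f i = y)
    (fd : ∀ i, dist (f i) (f (i + 1)) < δ) :
    ∃ (N : ℕ) (g : ℕ → X), 0 < N ∧ g 0 = x ∧ (∀ j, L * N ≤ j → g j = y) ∧
      (∀ j, dist (g j) (g (j + 1)) < δ') ∧ ∀ j, dist (g j) (f (j / N)) < ε := by
  have key : ∀ i, ∃ (N : ℕ) (c : ℕ → X), c 0 = f i ∧ (∀ j, N ≤ j → c j = f (i + 1)) ∧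
      (∀ j, dist (c j) (f i) < ε) ∧ (∀ j, dist (c j) (c (j + 1)) < δ') ∧ (L ≤ i → N = 0) := by
    intro i
    obtain ⟨S, hS, h1, h2, hSb⟩ := hδ _ _ (fd i)
    by_cases hi : L ≤ i
    · refine ⟨0, fun _ => f i, rfl, ?_, fun j => hSb h1, fun j => by simpa using hδ', fun _ => rfl⟩
      intro j _
      rw [fL i hi, fL (i + 1) (by omega)]
    · obtain ⟨N, c, c0, cN, cS, cd⟩ := hS.exists_chain hδ' h1 h2
      exact ⟨N, c, c0, cN, fun j => hSb (cS j), cd, fun h => absurd h hi⟩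
  choose n c c0 cn cb cd cL using key
  set N := (Finset.range L).sup n + 1 with hN
  have hn : ∀ i, n i ≤ N := by
    intro i
    by_cases hi : L ≤ i
    · simp [cL i hi]
    · exact (Finset.le_sup (f := n) (Finset.mem_range.2 (not_le.1 hi))).trans (Nat.le_succ _)
  have hN0 : 0 < N := Nat.succ_pos _
  refine ⟨N, fun j => c (j / N) (j % N), hN0, ?_, ?_, ?_, fun j => cb _ _⟩
  · simp [c0, f0]
  · intro j hj
    have h1 : L ≤ j / N := (Nat.le_div_iff_mul_le hN0).2 hj
    dsimp only
    rw [cn _ _ (by rw [cL _ h1]; exact Nat.zero_le _), fL _ (by omega)]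
  · intro j
    dsimp only
    by_cases h : j % N + 1 < N
    · have h1 : (j + 1) / N = j / N := by
        rw [Nat.succ_div_of_not_dvd]
        intro hd
        have := Nat.mod_add_div j N
        rw [Nat.dvd_iff_mod_eq_zero, Nat.add_mod, Nat.mod_eq_of_lt (b := N) (a := 1) (by omega),
          Nat.mod_eq_of_lt h] at hd
        omega
      have h2 : (j + 1) % N = j % N + 1 := by
        have e1 := Nat.mod_add_div j N
        have e2 := Nat.mod_add_div (j + 1) N
        rw [h1] at e2
        omega
      rw [h1, h2]
      exact cd _ _
    · have hlt := Nat.mod_lt j hN0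
      have e : j % N + 1 = N := by omega
      have e1 := Nat.mod_add_div j N
      have e2 : j + 1 = N * (j / N + 1) := by rw [Nat.mul_add, mul_one]; omega
      rw [e2, Nat.mul_mod_right, Nat.mul_div_cancel_left _ hN0, c0, ← cn (j / N) N (hn _)]
      have h := cd (j / N) (j % N)
      rwa [e] at h

/-- If short distances are bridged by small connected sets at every scale, then nearby points of a
complete space are joined by small paths. -/
theorem exists_path_of_uniform_connected {X : Type*} [MetricSpace X] [CompleteSpace X]
    {ε : ℝ} (hε : 0 < ε) (δ : ℕ → ℝ) (hδ0 : ∀ k, 0 < δ k) (hδε : ∀ k, δ k ≤ ε / 2 ^ k)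
    (hδ : ∀ k, ∀ x y : X, dist x y < δ k →
      ∃ S, IsPreconnected S ∧ x ∈ S ∧ y ∈ S ∧ S ⊆ ball x (ε / 2 ^ k))
    {x y : X} (hxy : dist x y < δ 0) : JoinedIn (ball x (4 * ε)) x y := by
  let St (k : ℕ) := {p : ℕ × (ℕ → X) // 0 < p.1 ∧ p.2 0 = x ∧ (∀ i, p.1 ≤ i → p.2 i = y) ∧
    ∀ i, dist (p.2 i) (p.2 (i + 1)) < δ k}
  have step : ∀ (k : ℕ) (s : St k), ∃ t : St (k + 1), ∃ N : ℕ, 0 < N ∧ t.1.1 = s.1.1 * N ∧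
      ∀ j, dist (t.1.2 j) (s.1.2 (j / N)) < ε / 2 ^ k := by
    rintro k ⟨⟨L, f⟩, hL, f0, fL, fd⟩
    obtain ⟨N, g, hN, g0, gL, gd, gf⟩ :=
      exists_chain_refinement (hδ0 (k + 1)) (hδ k) f0 fL fd
    exact ⟨⟨⟨L * N, g⟩, Nat.mul_pos hL hN, g0, gL, gd⟩, N, hN, rfl, gf⟩
  choose nx nN nN0 nL nd using step
  let s0 : St 0 := ⟨⟨1, fun i => if i = 0 then x else y⟩, one_pos, by simp,
    fun i hi => by simp [Nat.one_le_iff_ne_zero.mp hi], fun i => by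
      by_cases h : i = 0
      · simpa [h] using hxy
      · simpa [h] using hδ0 0⟩
  let s : ∀ k, St k := fun k => Nat.rec s0 (fun k t => nx k t) k
  let L : ℕ → ℕ := fun k => (s k).1.1
  let F : ℕ → unitInterval → X := fun k t => (s k).1.2 ⌊(t : ℝ) * L k⌋₊
  have hL0 : ∀ k, 0 < L k := fun k => (s k).2.1
  have hF : ∀ t k, dist (F k t) (F (k + 1) t) ≤ (2 * ε) / 2 / 2 ^ k := by
    intro t k
    have h := nd k (s k) ⌊(t : ℝ) * L (k + 1)⌋₊
    have e : L (k + 1) = L k * nN k (s k) := nL k (s k)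
    have e2 : ⌊(t : ℝ) * L (k + 1)⌋₊ / nN k (s k) = ⌊(t : ℝ) * L k⌋₊ := by
      rw [e, Nat.cast_mul, ← mul_assoc, Nat.mul_cast_floor_div_cancel (nN0 k (s k)).ne']
    rw [e2] at h
    rw [dist_comm, mul_div_cancel_left₀ _ two_ne_zero]
    exact h.le
  have hlim : ∀ t, ∃ a, Tendsto (fun k => F k t) atTop (𝓝 a) := fun t =>
    cauchySeq_tendsto_of_complete (cauchySeq_of_le_geometric_two (hF t))
  choose G hG using hlim
  have hFG : ∀ t k, dist (F k t) (G t) ≤ 2 * ε / 2 ^ k := fun t k =>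
    dist_le_of_le_geometric_two_of_tendsto (hF t) (hG t) k
  have hF1 : ∀ k (t u : unitInterval), t ≤ u → (u : ℝ) - t < 1 / L k →
      dist (F k t) (F k u) ≤ ε / 2 ^ k := by
    intro k t u htu h
    have hLk : (0 : ℝ) < L k := Nat.cast_pos.2 (hL0 k)
    have h1 : ⌊(t : ℝ) * L k⌋₊ ≤ ⌊(u : ℝ) * L k⌋₊ :=
      Nat.floor_mono (mul_le_mul_of_nonneg_right htu hLk.le)
    have h2 : ⌊(u : ℝ) * L k⌋₊ ≤ ⌊(t : ℝ) * L k⌋₊ + 1 := by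
      rw [← Nat.floor_add_one (mul_nonneg t.2.1 hLk.le)]
      apply Nat.floor_mono
      rw [lt_div_iff₀ hLk] at h
      linarith
    have hb : (0 : ℝ) ≤ ε / 2 ^ k := by positivity
    rcases Nat.of_le_succ h2 with h3 | h3
    · simp [F, le_antisymm h1 h3, hb]
    · simp only [F]
      rw [h3]
      exact (((s k).2.2.2.2 _).le).trans (hδε k)
  have hcont : Continuous G := by
    rw [Metric.continuous_iff]
    intro t η hη
    obtain ⟨k, hk⟩ : ∃ k : ℕ, 5 * ε / 2 ^ k < η := by
      obtain ⟨k, hk⟩ := exists_pow_lt_of_lt_one (div_pos hη (by positivity : 0 < 5 * ε))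
        (by norm_num : (1 / 2 : ℝ) < 1)
      refine ⟨k, ?_⟩
      rw [lt_div_iff₀ (by positivity)] at hk
      rw [div_eq_mul_inv, mul_comm]
      simpa using hk
    refine ⟨1 / L k, by have := hL0 k; positivity, fun u hu => ?_⟩
    have h1 : dist (F k u) (F k t) ≤ ε / 2 ^ k := by
      rw [Subtype.dist_eq, Real.dist_eq, abs_lt] at hu
      rcases le_total t u with h | h
      · rw [dist_comm]
        exact hF1 k t u h hu.2
      · exact hF1 k u t h (by linarith)
    have h2 := hFG u k
    have h3 := hFG t k
    have h4 := dist_triangle4 (G u) (F k u) (F k t) (G t)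
    rw [dist_comm (G u) (F k u)] at h4
    have h5 : 5 * ε / 2 ^ k = 2 * ε / 2 ^ k + ε / 2 ^ k + 2 * ε / 2 ^ k := by ring
    linarith
  have hG0 : G 0 = x := by
    refine tendsto_nhds_unique (hG 0) ?_
    have : ∀ k, F k 0 = x := fun k => by simpa [F] using (s k).2.2.1
    simp [this]
  have hG1 : G 1 = y := by
    refine tendsto_nhds_unique (hG 1) ?_
    have : ∀ k, F k 1 = y := fun k => by simpa [F] using (s k).2.2.2.1 (L k) le_rfl
    simp [this]
  refine ⟨⟨⟨G, hcont⟩, hG0, hG1⟩, fun t => ?_⟩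
  have h0 : dist (F 0 t) x < ε := by
    have h : F 0 t = x ∨ F 0 t = y := by
      change (if _ then x else y) = x ∨ (if _ then x else y) = y
      split_ifs <;> simp
    rcases h with h | h <;> rw [h]
    · simpa using hε
    · rw [dist_comm]
      exact hxy.trans_le (by simpa using hδε 0)
  have h1 := hFG t 0
  have h2 := dist_triangle (G t) (F 0 t) x
  rw [dist_comm (G t) (F 0 t)] at h2
  simp only [pow_zero, div_one] at h1
  change dist (G t) x < 4 * ε
  linarith

theorem exists_uniform_preconnected {X : Type*} [MetricSpace X] [CompactSpace X]
    [LocallyConnectedSpace X] {ε : ℝ} (hε : 0 < ε) :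
    ∃ δ > 0, ∀ x y : X, dist x y < δ →
      ∃ S, IsPreconnected S ∧ x ∈ S ∧ y ∈ S ∧ S ⊆ ball x ε := by
  obtain ⟨δ, hδ, h⟩ := lebesgue_number_lemma_of_metric (s := (univ : Set X))
    (c := fun z : X => connectedComponentIn (ball z (ε / 2)) z) isCompact_univ
    (fun z => isOpen_ball.connectedComponentIn)
    (fun z _ => mem_iUnion.2 ⟨z, mem_connectedComponentIn (mem_ball_self (half_pos hε))⟩)
  refine ⟨δ, hδ, fun x y hxy => ?_⟩
  obtain ⟨z, hz⟩ := h x (mem_univ x)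
  refine ⟨_, isPreconnected_connectedComponentIn, hz (mem_ball_self hδ),
    hz (by rwa [mem_ball, dist_comm]), fun w hw => ?_⟩
  have h1 := connectedComponentIn_subset _ _ hw
  have h2 := connectedComponentIn_subset _ _ (hz (mem_ball_self hδ))
  rw [mem_ball] at *
  have := dist_triangle_right w x z
  linarith

/-- Peano spaces are locally path-connected. -/
theorem LocallyConnectedSpace.locallyPathConnectedSpace (X : Type*) [MetricSpace X]
    [CompactSpace X] [LocallyConnectedSpace X] : LocallyPathConnectedSpace X := by
  have key : ∀ x : X, ∀ U ∈ 𝓝 x, pathComponentIn U x ∈ 𝓝 x := by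
    intro x U hU
    obtain ⟨r, hr, hrU⟩ := Metric.mem_nhds_iff.1 hU
    have hε : 0 < r / 4 := by positivity
    choose! δ hδ0 hδ using fun η (hη : (0 : ℝ) < η) => exists_uniform_preconnected (X := X) hη
    have hη : ∀ k : ℕ, 0 < r / 4 / 2 ^ k := fun k => by positivity
    have hj := fun y => exists_path_of_uniform_connected (x := x) (y := y) hε
      (fun k => min (δ (r / 4 / 2 ^ k)) (r / 4 / 2 ^ k))
      (fun k => lt_min (hδ0 _ (hη k)) (hη k)) (fun k => min_le_right _ _)
      (fun k a b hab => hδ _ (hη k) a b (hab.trans_le (min_le_left _ _)))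
    refine Filter.mem_of_superset (ball_mem_nhds x (lt_min (hδ0 _ (hη 0)) (hη 0)))
      fun y hy => ?_
    refine (hj y (by rwa [dist_comm])).mono ?_
    rwa [mul_div_cancel₀ _ (by norm_num : (4 : ℝ) ≠ 0)]
  refine LocallyPathConnectedSpace.of_bases (p := fun x s => s ∈ 𝓝 x)
    (s := fun x s => pathComponentIn s x) (fun x => ⟨fun t => ⟨fun ht => ⟨t, ht,
      pathComponentIn_subset⟩, fun ⟨s, hs, hst⟩ => Filter.mem_of_superset (key x s hs) hst⟩⟩)
    fun x s hs => isPathConnected_pathComponentIn (mem_of_mem_nhds hs)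

/-- `A` is a (possibly degenerate) arc from `a` to `b`. -/
def IsArcBetween {X : Type*} [TopologicalSpace X] (A : Set X) (a b : X) : Prop :=
  ∃ (u v : ℝ) (f : ℝ → X), u ≤ v ∧ ContinuousOn f (Icc u v) ∧ InjOn f (Icc u v) ∧
    f u = a ∧ f v = b ∧ f '' Icc u v = A

/-- The image of a path with order-convex fibres is an arc. -/
theorem isArcBetween_range {X : Type*} [MetricSpace X] {g : I → X} (hg : Continuous g)
    (hfib : ∀ s w t, s ≤ w → w ≤ t → g s = g t → g w = g s) :
    IsArcBetween (range g) (g 0) (g 1) := by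
  have hbd : ∀ S : Set I, Bornology.IsBounded (g '' S) := fun S =>
    (isCompact_range hg).isBounded.subset (image_subset_range g S)
  let ψ : I → I → ℝ := fun q t => diam (g '' Icc q t)
  have ψ_mono : ∀ q, Monotone (ψ q) := fun q t t' h =>
    diam_mono (image_mono (Icc_subset_Icc_right h)) (hbd _)
  have ψ_le : ∀ q t t', t ≤ t' → ψ q t' ≤ ψ q t + diam (g '' Icc t t') := by
    intro q t t' h
    rcases le_total q t with hq | hq
    · calc ψ q t' ≤ diam (g '' Icc q t ∪ g '' Icc t t') := by
            rw [← image_union]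
            exact diam_mono (image_mono Icc_subset_Icc_union_Icc) (hbd _)
        _ ≤ _ := diam_union' ⟨g t, mem_image_of_mem g ⟨hq, le_rfl⟩, mem_image_of_mem g ⟨le_rfl, h⟩⟩
    · exact (diam_mono (image_mono (Icc_subset_Icc_left hq)) (hbd _)).trans
        (le_add_of_nonneg_left diam_nonneg)
  have ψ_cont : ∀ q, Continuous (ψ q) := by
    intro q
    rw [Metric.continuous_iff]
    intro t ε hε
    obtain ⟨δ, hδ, H⟩ := Metric.uniformContinuous_iff.1
      (CompactSpace.uniformContinuous_of_continuous hg) (ε / 2) (half_pos hε)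
    have small : ∀ s t : I, s ≤ t → dist s t < δ → ψ q t - ψ q s < ε := by
      intro s t hst hd
      have h1 : diam (g '' Icc s t) ≤ ε / 2 := by
        refine diam_le_of_forall_dist_le (half_pos hε).le ?_
        rintro _ ⟨x, hx, rfl⟩ _ ⟨y, hy, rfl⟩
        refine (H ?_).le
        refine lt_of_le_of_lt ?_ hd
        rw [Subtype.dist_eq, Subtype.dist_eq]
        exact Real.dist_le_of_mem_uIcc (Icc_subset_uIcc hx) (Icc_subset_uIcc hy)
      have := ψ_le q s t hst
      linarith
    refine ⟨δ, hδ, fun u hu => ?_⟩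
    rw [Real.dist_eq, abs_lt]
    rcases le_total u t with h | h
    · have := small u t h hu
      have := ψ_mono q h
      constructor <;> linarith
    · have := small t u h (by rwa [dist_comm])
      have := ψ_mono q h
      constructor <;> linarith
  let D := diam (range g)
  have ψ_bd : ∀ q t, ψ q t ≤ D := fun q t =>
    diam_mono (image_subset_range g _) (isCompact_range hg).isBounded
  let e := TopologicalSpace.denseSeq I
  let F : ℕ → I → ℝ := fun n t => (1 / 2 : ℝ) ^ n * ψ (e n) t
  have hsum : Summable fun n : ℕ => (1 / 2 : ℝ) ^ n * D := summable_geometric_two.mul_right D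
  have F_le : ∀ n t, F n t ≤ (1 / 2 : ℝ) ^ n * D := fun n t =>
    mul_le_mul_of_nonneg_left (ψ_bd _ _) (by positivity)
  have F_nonneg : ∀ n t, 0 ≤ F n t := fun n t => mul_nonneg (by positivity) diam_nonneg
  have F_summable : ∀ t, Summable fun n => F n t := fun t =>
    Summable.of_nonneg_of_le (fun n => F_nonneg n t) (fun n => F_le n t) hsum
  let φ : I → ℝ := fun t => ∑' n, F n t
  have φ_cont : Continuous φ :=
    continuous_tsum (fun n => continuous_const.mul (ψ_cont _)) hsum fun n t => by
      rw [Real.norm_of_nonneg (F_nonneg n t)]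
      exact F_le n t
  have F_mono : ∀ n, Monotone (F n) := fun n s t h =>
    mul_le_mul_of_nonneg_left (ψ_mono _ h) (by positivity)
  have φ_mono : Monotone φ := fun s t h =>
    (F_summable s).tsum_le_tsum (fun n => F_mono n h) (F_summable t)
  have φ_strict : ∀ s t, s < t → g s ≠ g t → φ s < φ t := by
    intro s t hst hne
    have hev : ∀ᶠ q in 𝓝[>] s, q ∈ Ioo s t ∧ g q ≠ g t :=
      Filter.Eventually.and (Ioo_mem_nhdsGT hst)
        (nhdsWithin_le_nhds (hg.continuousAt.eventually_ne hne))
    have : (𝓝[>] s).NeBot := nhdsGT_neBot_of_exists_gt ⟨t, hst⟩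
    obtain ⟨q, hq⟩ := hev.exists
    have hopen : IsOpen {q | q ∈ Ioo s t ∧ g q ≠ g t} :=
      isOpen_Ioo.inter (isOpen_ne_fun hg continuous_const)
    obtain ⟨p, hp, n, rfl⟩ :=
      (TopologicalSpace.denseRange_denseSeq I).inter_open_nonempty _ hopen ⟨q, hq⟩
    refine Summable.tsum_lt_tsum (i := n) (fun n => F_mono n hst.le) ?_ (F_summable s)
      (F_summable t)
    refine mul_lt_mul_of_pos_left ?_ (by positivity)
    have h1 : ψ (e n) s = 0 := by
      simp only [ψ]
      rw [Icc_eq_empty (not_le.2 hp.1.1)]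
      simp
    rw [h1]
    exact (dist_pos.2 hp.2).trans_le (dist_le_diam_of_mem (hbd _)
      (mem_image_of_mem g ⟨le_rfl, hp.1.2.le⟩) (mem_image_of_mem g ⟨hp.1.2.le, le_rfl⟩))
  have φ_const : ∀ s t, s ≤ t → g s = g t → φ s = φ t := by
    intro s t hst heq
    refine tsum_congr fun n => ?_
    have h0 : diam (g '' Icc s t) = 0 := by
      refine diam_subsingleton ?_
      rintro _ ⟨x, hx, rfl⟩ _ ⟨y, hy, rfl⟩
      rw [hfib s x t hx.1 hx.2 heq, hfib s y t hy.1 hy.2 heq]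
    have h1 := ψ_le (e n) s t hst
    rw [h0, add_zero] at h1
    simp only [F]
    rw [le_antisymm (ψ_mono (e n) hst) h1]
  have φ_iff : ∀ s t, φ s = φ t ↔ g s = g t := by
    intro s t
    constructor
    · intro h
      by_contra hne
      rcases lt_trichotomy s t with hst | hst | hst
      · exact (φ_strict s t hst hne).ne h
      · exact hne (by rw [hst])
      · exact (φ_strict t s hst (Ne.symm hne)).ne h.symm
    · intro h
      rcases le_total s t with hst | hst
      · exact φ_const s t hst h
      · exact (φ_const t s hst h.symm).symm
  have hmem : ∀ t, φ t ∈ Icc (φ 0) (φ 1) := fun t => ⟨φ_mono t.2.1, φ_mono t.2.2⟩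
  let Φ : I → Icc (φ 0) (φ 1) := fun t => ⟨φ t, hmem t⟩
  have Φ_cont : Continuous Φ := φ_cont.subtype_mk _
  have Φ_surj : Function.Surjective Φ := by
    rintro ⟨x, hx⟩
    obtain ⟨t, ht⟩ := intermediate_value_univ 0 1 φ_cont hx
    exact ⟨t, Subtype.ext ht⟩
  have hq : IsQuotientMap Φ := Φ_cont.isClosedMap.isQuotientMap Φ_cont Φ_surj
  let τ : Icc (φ 0) (φ 1) → I := Function.surjInv Φ_surj
  have hτ : ∀ t, g (τ (Φ t)) = g t := fun t =>
    (φ_iff _ _).1 (congrArg Subtype.val (Function.surjInv_eq Φ_surj (Φ t)))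
  have f_cont : Continuous (g ∘ τ) := by
    rw [hq.continuous_iff]
    have : (g ∘ τ) ∘ Φ = g := funext hτ
    rwa [this]
  have h01 : φ 0 ≤ φ 1 := φ_mono zero_le_one
  have hext : ∀ t, IccExtend h01 (g ∘ τ) (φ t) = g t := by
    intro t
    rw [IccExtend_of_mem _ _ (hmem t)]
    exact hτ t
  have hsurj : ∀ x ∈ Icc (φ 0) (φ 1), ∃ t, φ t = x := fun x hx =>
    intermediate_value_univ 0 1 φ_cont hx
  refine ⟨φ 0, φ 1, IccExtend h01 (g ∘ τ), h01, f_cont.Icc_extend'.continuousOn, ?_, hext 0,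
    hext 1, ?_⟩
  · intro x hx y hy hxy
    obtain ⟨s, rfl⟩ := hsurj x hx
    obtain ⟨t, rfl⟩ := hsurj y hy
    rw [hext, hext] at hxy
    exact (φ_iff s t).2 hxy
  · ext z
    constructor
    · rintro ⟨x, hx, rfl⟩
      obtain ⟨s, rfl⟩ := hsurj x hx
      exact ⟨s, (hext s).symm⟩
    · rintro ⟨t, rfl⟩
      exact ⟨φ t, hmem t, hext t⟩

/-- Closed sets of parameters such that `γ` takes the same value at both ends of every gap. -/
def IsLoopErasure {X : Type*} (γ : I → X) (A : Set I) : Prop :=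
  IsClosed A ∧ 0 ∈ A ∧ 1 ∈ A ∧
    ∀ s ∈ A, ∀ t ∈ A, s < t → (∀ w ∈ A, s < w → ¬ w < t) → γ s = γ t

theorem isLoopErasure_sInter {X : Type*} [TopologicalSpace X] [T2Space X] {γ : I → X}
    (hγ : Continuous γ) {c : Set (Set I)} (hc : ∀ A ∈ c, IsLoopErasure γ A)
    (hchain : IsChain (· ⊆ ·) c) (hne : c.Nonempty) : IsLoopErasure γ (⋂₀ c) := by
  refine ⟨isClosed_sInter fun A hA => (hc A hA).1, fun A hA => (hc A hA).2.1,
    fun A hA => (hc A hA).2.2.1, fun s hs t ht hst hgap => ?_⟩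
  by_contra hγst
  obtain ⟨U', V', hU', hV', hsU, htV, hdisj⟩ := t2_separation hγst
  have hU := hU'.preimage hγ
  have hV := hV'.preimage hγ
  have hUV : ∀ w, γ w ∈ U' → γ w ∈ V' → False := fun w h1 h2 =>
    disjoint_left.1 hdisj h1 h2
  have hK : IsCompact (Icc s t \ (γ ⁻¹' U' ∪ γ ⁻¹' V')) :=
    isCompact_Icc.diff (hU.union hV)
  have : Nonempty c := hne.to_subtype
  obtain ⟨⟨A, hA⟩, hAK⟩ := hK.elim_directed_family_closed
    (fun A : c => (A : Set I)) (fun A => (hc A A.2).1) (by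
      ext w
      simp only [mem_inter_iff, Set.mem_sdiff, mem_union, mem_preimage, mem_iInter, Subtype.forall,
        mem_empty_iff_false, iff_false]
      rintro ⟨⟨hw, hw'⟩, hwc⟩
      rcases hw.1.eq_or_lt with rfl | h1
      · exact hw' (Or.inl hsU)
      rcases hw.2.eq_or_lt with rfl | h2
      · exact hw' (Or.inr htV)
      exact hgap w (fun A hA => hwc A hA) h1 h2) (by
      rintro ⟨A, hA⟩ ⟨B, hB⟩
      rcases hchain.total hA hB with h | h
      · exact ⟨⟨A, hA⟩, Subset.rfl, h⟩
      · exact ⟨⟨B, hB⟩, h, Subset.rfl⟩)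
  obtain ⟨hAc, -, -, hAgap⟩ := hc A hA
  have cover : ∀ w ∈ A, w ∈ Icc s t → γ w ∈ U' ∨ γ w ∈ V' := by
    intro w hwA hw
    by_contra h
    exact (eq_empty_iff_forall_notMem.1 hAK) w ⟨⟨hw, h⟩, hwA⟩
  obtain ⟨s', ⟨⟨hs't, hs'A⟩, hs'V⟩, hs'max⟩ :=
    ((isCompact_Icc (a := s) (b := t)).inter_right hAc |>.diff hV).exists_isGreatest
      ⟨s, ⟨⟨le_rfl, hst.le⟩, hs A hA⟩, fun h => hUV s hsU h⟩
  have hs't' : s' < t := lt_of_le_of_ne hs't.2 (fun h => hs'V (by rw [h]; exact htV))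
  obtain ⟨t', ⟨⟨ht't, ht'A⟩, ht'U⟩, ht'min⟩ :=
    ((isCompact_Icc (a := s') (b := t)).inter_right hAc |>.diff hU).exists_isLeast
      ⟨t, ⟨⟨hs't'.le, le_rfl⟩, ht A hA⟩, fun h => hUV t h htV⟩
  have hs'U : γ s' ∈ U' := (cover s' hs'A hs't).resolve_right hs'V
  have ht'V : γ t' ∈ V' := (cover t' ht'A ⟨hs't.1.trans ht't.1, ht't.2⟩).resolve_left ht'U
  have hlt : s' < t' := lt_of_le_of_ne ht't.1 (fun h => ht'U (by rw [← h]; exact hs'U))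
  have heq := hAgap s' hs'A t' ht'A hlt (by
    intro w hwA h1 h2
    have hwt : w ≤ t := h2.le.trans ht't.2
    by_cases hwV : γ w ∈ V'
    · exact absurd (ht'min ⟨⟨⟨h1.le, hwt⟩, hwA⟩, fun h => hUV w h hwV⟩) (not_le.2 h2)
    · exact absurd (hs'max ⟨⟨⟨hs't.1.trans h1.le, hwt⟩, hwA⟩, hwV⟩) (not_le.2 h1))
  exact hUV t' (heq ▸ hs'U) ht'V

theorem exists_path_convex_fibers {X : Type*} [MetricSpace X] {γ : I → X} (hγ : Continuous γ) :
    ∃ g : I → X, Continuous g ∧ (∀ s w t, s ≤ w → w ≤ t → g s = g t → g w = g s) ∧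
      g 0 = γ 0 ∧ g 1 = γ 1 ∧ range g ⊆ range γ := by
  obtain ⟨A, -, ⟨hAc, h0, h1, hgap⟩, hmin⟩ := zorn_superset_nonempty {A | IsLoopErasure γ A}
    (fun c hc hchain hne =>
      ⟨⋂₀ c, isLoopErasure_sInter hγ hc hchain hne, fun s hs => sInter_subset_of_mem hs⟩)
    univ ⟨isClosed_univ, mem_univ _, mem_univ _, fun s _ t _ hst h => by
      obtain ⟨w, hw⟩ := exists_between hst
      exact absurd hw.2 (h w (mem_univ w) hw.1)⟩
  have hloop : ∀ s ∈ A, ∀ t ∈ A, γ s = γ t → ∀ w ∈ A, s < w → ¬ w < t := by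
    intro s hs t ht hst w hw hsw hwt
    have hs' : s ∈ A \ Ioo s t := ⟨hs, fun h => lt_irrefl _ h.1⟩
    have ht' : t ∈ A \ Ioo s t := ⟨ht, fun h => lt_irrefl _ h.2⟩
    have := hmin (y := A \ Ioo s t) ⟨hAc.sdiff isOpen_Ioo, ⟨h0, fun h => not_lt_bot h.1⟩,
      ⟨h1, fun h => not_top_lt h.2⟩, ?_⟩ sdiff_subset hw
    · exact this.2 ⟨hsw, hwt⟩
    · intro u hu v hv huv hg
      by_cases hex : ∃ z ∈ A, u < z ∧ z < v
      · obtain ⟨z, hzA, hz1, hz2⟩ := hex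
        have hz : z ∈ Ioo s t := by
          by_contra h
          exact hg z ⟨hzA, h⟩ hz1 hz2
        have hsu : s ≤ u := by
          by_contra! h
          exact hg s hs' h (hz.1.trans hz2)
        have htv : v ≤ t := by
          by_contra! h
          exact hg t ht' (hz1.trans hz.2) h
        have hu' : u = s := by
          by_contra h
          exact hu.2 ⟨lt_of_le_of_ne hsu (Ne.symm h), hz1.trans hz.2⟩
        have hv' : v = t := by
          by_contra h
          exact hv.2 ⟨hz.1.trans hz2, lt_of_le_of_ne htv h⟩
        rw [hu', hv', hst]
      · push Not at hex
        exact hgap u hu.1 v hv.1 huv fun w hw h => not_lt.2 (hex w hw h)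
  have hr : ∀ t, ∃ r, IsGreatest (A ∩ Iic t) r := fun t =>
    (hAc.inter isClosed_Iic).isCompact.exists_isGreatest ⟨0, h0, t.2.1⟩
  have hl : ∀ t, ∃ l, IsLeast (A ∩ Ici t) l := fun t =>
    (hAc.inter isClosed_Ici).isCompact.exists_isLeast ⟨1, h1, t.2.2⟩
  choose r hr using hr
  choose l hl using hl
  have r_le : ∀ t, r t ≤ t := fun t => (hr t).1.2
  have le_l : ∀ t, t ≤ l t := fun t => (hl t).1.2
  have r_fix : ∀ t ∈ A, r t = t := fun t ht =>
    le_antisymm (r_le t) ((hr t).2 ⟨ht, mem_Iic.2 le_rfl⟩)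
  have r_mono : Monotone r := fun s t h => (hr t).2 ⟨(hr s).1.1, (r_le s).trans h⟩
  have rl : ∀ t, γ (r t) = γ (l t) := by
    intro t
    rcases ((r_le t).trans (le_l t)).eq_or_lt with h | h
    · rw [h]
    · refine hgap _ (hr t).1.1 _ (hl t).1.1 h fun w hw h1 h2 => ?_
      rcases le_total w t with hwt | hwt
      · exact absurd ((hr t).2 ⟨hw, hwt⟩) (not_le.2 h1)
      · exact absurd ((hl t).2 ⟨hw, hwt⟩) (not_le.2 h2)
  refine ⟨γ ∘ r, ?_, ?_, by simp [r_fix 0 h0], by simp [r_fix 1 h1], range_comp_subset_range _ _⟩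
  · refine UniformContinuous.continuous (Metric.uniformContinuous_iff.2 fun ε hε => ?_)
    obtain ⟨δ, hδ, H⟩ := Metric.uniformContinuous_iff.1
      (CompactSpace.uniformContinuous_of_continuous hγ) ε hε
    have small : ∀ s t : I, s ≤ t → dist s t < δ → dist (γ (r s)) (γ (r t)) < ε := by
      intro s t hst hd
      rcases le_or_gt (r t) s with h | h
      · have : r s = r t := le_antisymm (r_mono hst) ((hr s).2 ⟨(hr t).1.1, h⟩)
        rwa [this, dist_self]
      · rw [rl s]
        refine H (lt_of_le_of_lt ?_ hd)
        have h2 : l s ≤ r t := (hl s).2 ⟨(hr t).1.1, h.le⟩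
        rw [Subtype.dist_eq, Subtype.dist_eq]
        exact Real.dist_le_of_mem_uIcc
          (Icc_subset_uIcc ⟨le_l s, h2.trans (r_le t)⟩)
          (Icc_subset_uIcc ⟨h.le, r_le t⟩)
    refine ⟨δ, hδ, fun {s t} hst => ?_⟩
    rcases le_total s t with h | h
    · exact small s t h hst
    · rw [dist_comm]
      exact small t s h (by rwa [dist_comm])
  · intro s w t hsw hwt hst
    have h1 := r_mono hsw
    have h2 := r_mono hwt
    simp only [Function.comp] at hst ⊢
    rcases h1.eq_or_lt with h | h
    · rw [h]
    rcases h2.eq_or_lt with h' | h'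
    · rw [h', hst]
    exact absurd h' (hloop _ (hr s).1.1 _ (hr t).1.1 hst _ (hr w).1.1 h)

theorem JoinedIn.exists_isArcBetween {X : Type*} [MetricSpace X] {S : Set X} {a b : X}
    (h : JoinedIn S a b) : ∃ A ⊆ S, IsArcBetween A a b := by
  obtain ⟨γ, hγ⟩ := h
  obtain ⟨g, hg, hfib, h0, h1, hsub⟩ := exists_path_convex_fibers γ.continuous
  refine ⟨range g, hsub.trans (range_subset_iff.2 hγ), ?_⟩
  have := isArcBetween_range hg hfib
  rwa [h0, h1, γ.source, γ.target] at this

section Arcs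

variable {X : Type*} [TopologicalSpace X]

theorem exists_continuousOn_concat {u v u' v' : ℝ} (huv : u ≤ v) (huv' : u' ≤ v') {f g : ℝ → X}
    (hf : ContinuousOn f (Icc u v)) (hg : ContinuousOn g (Icc u' v')) (hfg : f v = g u') :
    ∃ h : ℝ → X, ContinuousOn h (Icc u (v + (v' - u'))) ∧ (∀ x ≤ v, h x = f x) ∧
      ∀ x, v ≤ x → h x = g (x - v + u') := by
  classical
  let h : ℝ → X := fun x => if x ≤ v then f x else g (x - v + u')
  have h1 : ∀ x ≤ v, h x = f x := fun x hx => if_pos hx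
  have h2 : ∀ x, v ≤ x → h x = g (x - v + u') := by
    intro x hx
    rcases hx.eq_or_lt with rfl | hx
    · rw [h1 v le_rfl, hfg]
      simp
    · exact if_neg (not_le.2 hx)
  refine ⟨h, ?_, h1, h2⟩
  rw [← Icc_union_Icc_eq_Icc huv (by linarith : v ≤ v + (v' - u'))]
  refine ContinuousOn.union_of_isClosed ?_ ?_ isClosed_Icc isClosed_Icc
  · exact hf.congr fun x hx => h1 x hx.2
  · refine ContinuousOn.congr ?_ fun x hx => h2 x hx.1
    refine hg.comp (by fun_prop) fun x hx => ?_
    constructor <;> linarith [hx.1, hx.2]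

namespace IsArcBetween

variable {A B : Set X} {a b c : X}

theorem left_mem (h : IsArcBetween A a b) : a ∈ A := by
  obtain ⟨u, v, f, huv, -, -, rfl, -, rfl⟩ := h
  exact mem_image_of_mem f ⟨le_rfl, huv⟩

theorem right_mem (h : IsArcBetween A a b) : b ∈ A := by
  obtain ⟨u, v, f, huv, -, -, -, rfl, rfl⟩ := h
  exact mem_image_of_mem f ⟨huv, le_rfl⟩

theorem symm (h : IsArcBetween A a b) : IsArcBetween A b a := by
  obtain ⟨u, v, f, huv, hf, hinj, rfl, rfl, rfl⟩ := h
  have hmem : ∀ x ∈ Icc (-v) (-u), -x ∈ Icc u v := fun x hx =>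
    ⟨by linarith [hx.2], by linarith [hx.1]⟩
  refine ⟨-v, -u, fun x => f (-x), neg_le_neg huv, hf.comp (by fun_prop) hmem, ?_, by simp,
    by simp, ?_⟩
  · intro x hx y hy hxy
    exact neg_injective (hinj (hmem x hx) (hmem y hy) hxy)
  · ext z
    constructor
    · rintro ⟨x, hx, rfl⟩
      exact ⟨-x, hmem x hx, rfl⟩
    · rintro ⟨x, hx, rfl⟩
      exact ⟨-x, ⟨neg_le_neg hx.2, neg_le_neg hx.1⟩, by simp⟩

theorem trans (hA : IsArcBetween A a b) (hB : IsArcBetween B b c) (hAB : A ∩ B ⊆ {b}) :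
    IsArcBetween (A ∪ B) a c := by
  obtain ⟨u, v, f, huv, hf, finj, rfl, rfl, rfl⟩ := hA
  obtain ⟨u', v', g, huv', hg, ginj, hgf, rfl, rfl⟩ := hB
  obtain ⟨h, hc, h1, h2⟩ := exists_continuousOn_concat huv huv' hf hg hgf.symm
  have hvw : v ≤ v + (v' - u') := by linarith
  have hmem : ∀ x ∈ Icc v (v + (v' - u')), x - v + u' ∈ Icc u' v' := fun x hx =>
    ⟨by linarith [hx.1], by linarith [hx.2]⟩
  have hinj : ∀ x ∈ Icc u (v + (v' - u')), ∀ y ∈ Icc u (v + (v' - u')), x ≤ y → h x = h y →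
      x = y := by
    intro x hx y hy hle hxy
    rcases le_total y v with hyv | hyv
    · rw [h1 y hyv, h1 x (hle.trans hyv)] at hxy
      exact finj ⟨hx.1, hle.trans hyv⟩ ⟨hy.1, hyv⟩ hxy
    have hy' := hmem y ⟨hyv, hy.2⟩
    rcases le_total x v with hxv | hxv
    · rw [h2 y hyv, h1 x hxv] at hxy
      have hb := hAB ⟨mem_image_of_mem f ⟨hx.1, hxv⟩, hxy ▸ mem_image_of_mem g hy'⟩
      have e1 := finj ⟨hx.1, hxv⟩ ⟨huv, le_rfl⟩ hb
      have e2 := ginj hy' ⟨le_rfl, huv'⟩ (by rw [← hxy, hgf]; exact hb)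
      linarith
    · rw [h2 y hyv, h2 x hxv] at hxy
      have := ginj (hmem x ⟨hxv, hx.2⟩) hy' hxy
      linarith
  refine ⟨u, v + (v' - u'), h, huv.trans hvw, hc, ?_, h1 u huv, ?_, ?_⟩
  · intro x hx y hy hxy
    rcases le_total x y with hle | hle
    · exact hinj x hx y hy hle hxy
    · exact (hinj y hy x hx hle hxy.symm).symm
  · rw [h2 _ hvw]
    congr 1
    ring
  · rw [← Icc_union_Icc_eq_Icc huv hvw, image_union]
    congr 1
    · exact image_congr fun x hx => h1 x hx.2
    · ext z
      constructor
      · rintro ⟨x, hx, rfl⟩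
        exact ⟨_, hmem x hx, (h2 x hx.1).symm⟩
      · rintro ⟨x, hx, rfl⟩
        refine ⟨x - u' + v, ⟨by linarith [hx.1], by linarith [hx.2]⟩, ?_⟩
        rw [h2 _ (by linarith [hx.1])]
        congr 1
        ring

/-- The initial part of an arc up to its first point in a closed set. -/
theorem exists_first_hit [T2Space X] (hA : IsArcBetween A a b) {F : Set X} (hF : IsClosed F)
    (hb : b ∈ F) : ∃ w ∈ F, ∃ A' ⊆ A, IsArcBetween A' a w ∧ A' ∩ F ⊆ {w} := by
  obtain ⟨u, v, f, huv, hf, finj, rfl, rfl, rfl⟩ := hA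
  have hK : IsCompact (Icc u v ∩ f ⁻¹' F) :=
    isCompact_Icc.of_isClosed_subset (hf.preimage_isClosed_of_isClosed isClosed_Icc hF)
      inter_subset_left
  obtain ⟨t, ⟨ht, htF⟩, hmin⟩ := hK.exists_isLeast ⟨v, ⟨huv, le_rfl⟩, hb⟩
  have hsub : Icc u t ⊆ Icc u v := Icc_subset_Icc_right ht.2
  refine ⟨f t, htF, f '' Icc u t, image_mono hsub,
    ⟨u, t, f, ht.1, hf.mono hsub, finj.mono hsub, rfl, rfl, rfl⟩, ?_⟩
  rintro _ ⟨⟨x, hx, rfl⟩, hxF⟩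
  rw [mem_singleton_iff, le_antisymm hx.2 (hmin ⟨hsub hx, hxF⟩)]

end IsArcBetween

/-- The unit circle of `ℂ` is the model circle. -/
noncomputable def circleHomeomorph : Circle ≃ₜ Circle1 :=
  Complex.orthonormalBasisOneI.repr.toHomeomorph.subtype (p := fun z => z ∈ Submonoid.unitSphere ℂ)
    (q := fun z => z ∈ Circle1) fun z => by
      simp [Circle1, Submonoid.unitSphere]

theorem isJordanCurve_image [T2Space X] {u v : ℝ} (huv : u < v) {f : ℝ → X}
    (hf : ContinuousOn f (Icc u v)) (hinj : InjOn f (Ico u v)) (heq : f u = f v) :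
    IsJordanCurve (f '' Icc u v) := by
  obtain ⟨p, rfl⟩ : ∃ p, v = u + p := ⟨v - u, by ring⟩
  have hp : 0 < p := by linarith
  have : Fact (0 < p) := ⟨hp⟩
  have hc : Continuous (AddCircle.liftIco p u f) := AddCircle.liftIco_continuous heq hf
  have hrep : ∀ z : AddCircle p, ∃ x ∈ Ico u (u + p), (x : AddCircle p) = z := by
    intro z
    have : z ∈ ((↑) : ℝ → AddCircle p) '' Ico u (u + p) := by
      rw [AddCircle.coe_image_Ico_eq]
      trivial
    exact this
  have hi : Function.Injective (AddCircle.liftIco p u f) := by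
    intro z w hzw
    obtain ⟨x, hx, rfl⟩ := hrep z
    obtain ⟨y, hy, rfl⟩ := hrep w
    rw [AddCircle.liftIco_coe_apply hx, AddCircle.liftIco_coe_apply hy] at hzw
    rw [hinj hx hy hzw]
  have hr : range (AddCircle.liftIco p u f) = f '' Icc u (u + p) := by
    ext z
    constructor
    · rintro ⟨w, rfl⟩
      obtain ⟨x, hx, rfl⟩ := hrep w
      rw [AddCircle.liftIco_coe_apply hx]
      exact mem_image_of_mem f (Ico_subset_Icc_self hx)
    · rintro ⟨x, hx, rfl⟩
      rcases hx.2.eq_or_lt with rfl | h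
      · exact ⟨(u : AddCircle p), by rw [AddCircle.liftIco_coe_apply ⟨le_rfl, huv⟩, heq]⟩
      · exact ⟨(x : AddCircle p), AddCircle.liftIco_coe_apply ⟨hx.1, h⟩⟩
  rw [← hr]
  exact ⟨(hc.isClosedEmbedding hi).isEmbedding.toHomeomorph.symm.trans
    ((AddCircle.homeomorphCircle hp.ne').trans circleHomeomorph)⟩

theorem IsJordanCurve.exists_param {J : Set X} (hJ : IsJordanCurve J) {a : X} (ha : a ∈ J) :
    ∃ (u v : ℝ) (f : ℝ → X), u < v ∧ ContinuousOn f (Icc u v) ∧ InjOn f (Ico u v) ∧ f u = a ∧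
      f v = a ∧ f '' Icc u v = J := by
  obtain ⟨e'⟩ := hJ
  let e : J ≃ₜ AddCircle (1 : ℝ) :=
    e'.trans (circleHomeomorph.symm.trans (AddCircle.homeomorphCircle one_ne_zero).symm)
  obtain ⟨u, hu⟩ := QuotientAddGroup.mk_surjective (e ⟨a, ha⟩)
  have hu : (u : AddCircle (1 : ℝ)) = e ⟨a, ha⟩ := hu
  let f : ℝ → X := fun x => (e.symm (x : AddCircle (1 : ℝ)) : X)
  have hfu : f u = a := by simp [f, hu]
  refine ⟨u, u + 1, f, by linarith, ?_, ?_, hfu, ?_, ?_⟩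
  · exact (continuous_subtype_val.comp
      (e.symm.continuous.comp (AddCircle.continuous_mk' 1))).continuousOn
  · intro x hx y hy hxy
    have h1 := e.symm.injective (Subtype.ext hxy)
    have : Fact ((0 : ℝ) < 1) := ⟨one_pos⟩
    exact (AddCircle.coe_eq_coe_iff_of_mem_Ico hx hy).1 h1
  · rw [← hfu]
    simp only [f]
    rw [AddCircle.coe_add_period]
  · ext z
    constructor
    · rintro ⟨x, -, rfl⟩
      exact (e.symm _).2
    · intro hz
      have : Fact ((0 : ℝ) < 1) := ⟨one_pos⟩
      have h : e ⟨z, hz⟩ ∈ ((↑) : ℝ → AddCircle (1 : ℝ)) '' Icc u (u + 1) := by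
        rw [AddCircle.coe_image_Icc_eq]
        trivial
      obtain ⟨x, hx, hxz⟩ := h
      exact ⟨x, hx, by simp [f, hxz]⟩

theorem IsJordanCurve.isCompact {J : Set X} (hJ : IsJordanCurve J) : IsCompact J := by
  obtain ⟨e⟩ := hJ
  have : CompactSpace Circle1 := isCompact_iff_compactSpace.1 (isCompact_sphere _ _)
  exact isCompact_iff_compactSpace.2 e.symm.compactSpace

/-- Two distinct points of a Jordan curve split it into two arcs. -/
theorem IsJordanCurve.exists_arcs {J : Set X} (hJ : IsJordanCurve J) {a b : X} (ha : a ∈ J)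
    (hb : b ∈ J) (hab : a ≠ b) :
    ∃ A B, IsArcBetween A a b ∧ IsArcBetween B a b ∧ A ∪ B = J ∧ A ∩ B = {a, b} := by
  obtain ⟨u, v, f, huv, hf, hinj, hfu, hfv, rfl⟩ := hJ.exists_param ha
  obtain ⟨t, ht, rfl⟩ := hb
  have hut : u < t := lt_of_le_of_ne ht.1 (by rintro rfl; exact hab hfu.symm)
  have htv : t < v := lt_of_le_of_ne ht.2 (by rintro rfl; exact hab hfv.symm)
  have i1 : InjOn f (Icc u t) := hinj.mono (Icc_subset_Ico_right htv)
  have i2 : InjOn f (Icc t v) := by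
    have key : ∀ x ∈ Icc t v, f x = f v → x = v := by
      intro x hx h
      by_contra hne
      have : x = u := hinj ⟨ht.1.trans hx.1, lt_of_le_of_ne hx.2 hne⟩ ⟨le_rfl, huv⟩
        (by rw [h, hfu, hfv])
      linarith [hx.1]
    intro x hx y hy hxy
    rcases hx.2.eq_or_lt with rfl | hxv
    · exact (key y hy hxy.symm).symm
    rcases hy.2.eq_or_lt with rfl | hyv
    · exact key x hx hxy
    exact hinj ⟨ht.1.trans hx.1, hxv⟩ ⟨ht.1.trans hy.1, hyv⟩ hxy
  refine ⟨f '' Icc u t, f '' Icc t v,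
    ⟨u, t, f, ht.1, hf.mono (Icc_subset_Icc_right ht.2), i1, hfu, rfl, rfl⟩,
    IsArcBetween.symm ⟨t, v, f, ht.2, hf.mono (Icc_subset_Icc_left ht.1), i2, rfl, hfv, rfl⟩,
    ?_, ?_⟩
  · rw [← image_union, Icc_union_Icc_eq_Icc ht.1 ht.2]
  · apply Subset.antisymm
    · rintro _ ⟨⟨x, hx, rfl⟩, y, hy, hxy⟩
      rcases hy.2.eq_or_lt with rfl | hyv
      · left
        rw [← hxy, hfv]
      · right
        have := hinj ⟨ht.1.trans hy.1, hyv⟩ ⟨hx.1, hx.2.trans_lt htv⟩ hxy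
        have : x = t := le_antisymm hx.2 (this ▸ hy.1)
        rw [this]
        exact mem_singleton _
    · rintro z (rfl | rfl)
      · exact ⟨⟨u, ⟨le_rfl, ht.1⟩, hfu⟩, v, ⟨ht.2, le_rfl⟩, hfv⟩
      · exact ⟨⟨t, ⟨ht.1, le_rfl⟩, rfl⟩, t, ⟨le_rfl, ht.2⟩, rfl⟩

/-- Two arcs with the same distinct end points and no other common points form a Jordan curve. -/
theorem IsArcBetween.isJordanCurve_union [T2Space X] {A B : Set X} {a b : X}
    (hA : IsArcBetween A a b) (hB : IsArcBetween B a b) (hab : a ≠ b) (hAB : A ∩ B ⊆ {a, b}) :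
    IsJordanCurve (A ∪ B) := by
  obtain ⟨u, v, f, huv, hf, finj, rfl, rfl, rfl⟩ := hA
  obtain ⟨u', v', g, huv', hg, ginj, hgb, hga, rfl⟩ := hB.symm
  have hlt' : u' < v' := lt_of_le_of_ne huv' (by rintro rfl; exact hab (hga.symm.trans hgb))
  obtain ⟨h, hc, h1, h2⟩ := exists_continuousOn_concat huv huv' hf hg hgb.symm
  have hvw : v ≤ v + (v' - u') := by linarith
  have hmem : ∀ x ∈ Icc v (v + (v' - u')), x - v + u' ∈ Icc u' v' := fun x hx =>
    ⟨by linarith [hx.1], by linarith [hx.2]⟩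
  have himg : h '' Icc u (v + (v' - u')) = f '' Icc u v ∪ g '' Icc u' v' := by
    rw [← Icc_union_Icc_eq_Icc huv hvw, image_union]
    congr 1
    · exact image_congr fun x hx => h1 x hx.2
    · ext z
      constructor
      · rintro ⟨x, hx, rfl⟩
        exact ⟨_, hmem x hx, (h2 x hx.1).symm⟩
      · rintro ⟨x, hx, rfl⟩
        refine ⟨x - u' + v, ⟨by linarith [hx.1], by linarith [hx.2]⟩, ?_⟩
        rw [h2 _ (by linarith [hx.1])]
        congr 1
        ring
  have hinj : ∀ x ∈ Ico u (v + (v' - u')), ∀ y ∈ Ico u (v + (v' - u')), x ≤ y → h x = h y →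
      x = y := by
    intro x hx y hy hle hxy
    rcases le_total y v with hyv | hyv
    · rw [h1 y hyv, h1 x (hle.trans hyv)] at hxy
      exact finj ⟨hx.1, hle.trans hyv⟩ ⟨hy.1, hyv⟩ hxy
    have hy' := hmem y ⟨hyv, hy.2.le⟩
    rcases le_total x v with hxv | hxv
    · rw [h2 y hyv, h1 x hxv] at hxy
      rcases hAB ⟨mem_image_of_mem f ⟨hx.1, hxv⟩, hxy ▸ mem_image_of_mem g hy'⟩ with hb | hb
      · have e2 := ginj hy' ⟨huv', le_rfl⟩ (by rw [← hxy, hga]; exact hb)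
        linarith [hy.2]
      · have e1 := finj ⟨hx.1, hxv⟩ ⟨huv, le_rfl⟩ hb
        have e2 := ginj hy' ⟨le_rfl, huv'⟩ (by rw [← hxy, hgb]; exact hb)
        linarith
    · rw [h2 y hyv, h2 x hxv] at hxy
      have := ginj (hmem x ⟨hxv, hx.2.le⟩) hy' hxy
      linarith
  rw [← himg]
  refine isJordanCurve_image (by linarith) hc ?_ ?_
  · intro x hx y hy hxy
    rcases le_total x y with hle | hle
    · exact hinj x hx y hy hle hxy
    · exact (hinj y hy x hx hle hxy.symm).symm
  · rw [h1 u huv, h2 _ hvw, ← hga]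
    congr 1
    ring

end Arcs

section CyclicSets

variable {X : Type*} [TopologicalSpace X]

/-- Any two points of a cyclicly connected set are joined by an arc through a given third point. -/
theorem CycliclyConnected.exists_isArcBetween_mem [T2Space X] {T : Set X}
    (hT : CycliclyConnected T) {a b v : X} (ha : a ∈ T) (hb : b ∈ T) (hab : a ≠ b) (hv : v ∈ T) :
    ∃ A ⊆ T, IsArcBetween A a b ∧ v ∈ A := by
  have harc : ∃ A ⊆ T, IsArcBetween A a b := by
    obtain ⟨J, hJT, hJ, haJ, hbJ⟩ := hT a ha b hb hab
    obtain ⟨A, B, hA, -, hAB, -⟩ := hJ.exists_arcs haJ hbJ hab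
    exact ⟨A, (hAB ▸ subset_union_left).trans hJT, hA⟩
  by_cases hva : v = a
  · obtain ⟨A, hAT, hA⟩ := harc
    exact ⟨A, hAT, hA, hva ▸ hA.left_mem⟩
  by_cases hvb : v = b
  · obtain ⟨A, hAT, hA⟩ := harc
    exact ⟨A, hAT, hA, hvb ▸ hA.right_mem⟩
  obtain ⟨J, hJT, hJ, haJ, hvJ⟩ := hT a ha v hv (Ne.symm hva)
  obtain ⟨J', hJ'T, hJ', hbJ', hvJ'⟩ := hT b hb v hv (Ne.symm hvb)
  obtain ⟨α, hαT, hα, haα⟩ : ∃ A ⊆ T, IsArcBetween A b v ∧ a ∉ A := by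
    obtain ⟨A, B, hA, hB, hAB, hAB'⟩ := hJ'.exists_arcs hbJ' hvJ' (Ne.symm hvb)
    by_cases haA : a ∈ A
    · refine ⟨B, (hAB ▸ subset_union_right).trans hJ'T, hB, fun haB => ?_⟩
      have : a ∈ ({b, v} : Set X) := hAB' ▸ ⟨haA, haB⟩
      rcases this with h | h
      exacts [hab h, hva h.symm]
    · exact ⟨A, (hAB ▸ subset_union_left).trans hJ'T, hA, haA⟩
  obtain ⟨w, hwJ, α', hα'α, hα', hα'J⟩ := hα.exists_first_hit hJ.isCompact.isClosed hvJ
  have hwa : w ≠ a := fun h => haα (h ▸ hα'α hα'.right_mem)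
  obtain ⟨β, hβJ, hβ, hvβ⟩ : ∃ B ⊆ J, IsArcBetween B w a ∧ v ∈ B := by
    obtain ⟨A, B, hA, hB, hAB, -⟩ := hJ.exists_arcs hwJ haJ hwa
    rw [← hAB] at hvJ
    rcases hvJ with h | h
    · exact ⟨A, hAB ▸ subset_union_left, hA, h⟩
    · exact ⟨B, hAB ▸ subset_union_right, hB, h⟩
  exact ⟨α' ∪ β, union_subset (hα'α.trans hαT) (hβJ.trans hJT),
    (hα'.trans hβ ((inter_subset_inter_right _ hβJ).trans hα'J)).symm, Or.inr hvβ⟩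

/-- Attaching an arc at two distinct points preserves cyclic connectedness. -/
theorem CycliclyConnected.union_arc [T2Space X] {T A : Set X} {a b : X}
    (hT : CycliclyConnected T) (hA : IsArcBetween A a b) (ha : a ∈ T) (hb : b ∈ T) (hab : a ≠ b)
    (hAT : A ∩ T ⊆ {a, b}) : CycliclyConnected (T ∪ A) := by
  have key : ∀ v ∈ T, ∃ J ⊆ T ∪ A, IsJordanCurve J ∧ A ⊆ J ∧ v ∈ J := by
    intro v hv
    obtain ⟨B, hBT, hB, hvB⟩ := hT.exists_isArcBetween_mem ha hb hab hv
    exact ⟨A ∪ B, union_subset subset_union_right (hBT.trans subset_union_left),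
      hA.isJordanCurve_union hB hab ((inter_subset_inter_right _ hBT).trans hAT),
      subset_union_left, Or.inr hvB⟩
  intro x hx y hy hxy
  rcases hx with hx | hx <;> rcases hy with hy | hy
  · obtain ⟨J, hJT, hJ, h⟩ := hT x hx y hy hxy
    exact ⟨J, hJT.trans subset_union_left, hJ, h⟩
  · obtain ⟨J, hJT, hJ, hAJ, hvJ⟩ := key x hx
    exact ⟨J, hJT, hJ, hvJ, hAJ hy⟩
  · obtain ⟨J, hJT, hJ, hAJ, hvJ⟩ := key y hy
    exact ⟨J, hJT, hJ, hAJ hx, hvJ⟩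
  · obtain ⟨J, hJT, hJ, hAJ, -⟩ := key a ha
    exact ⟨J, hJT, hJ, hAJ hx, hAJ hy⟩

theorem IsArcBetween.exists_mem_ne {A : Set X} {a b : X} (hA : IsArcBetween A a b)
    (hab : a ≠ b) : ∃ c ∈ A, c ≠ a ∧ c ≠ b := by
  obtain ⟨u, v, f, huv, -, hinj, rfl, rfl, rfl⟩ := hA
  have hlt : u < v := lt_of_le_of_ne huv (by rintro rfl; exact hab rfl)
  obtain ⟨w, huw, hwv⟩ := exists_between hlt
  have hw : w ∈ Icc u v := ⟨huw.le, hwv.le⟩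
  exact ⟨f w, mem_image_of_mem f hw, hinj.ne hw ⟨le_rfl, huv⟩ huw.ne',
    hinj.ne hw ⟨huv, le_rfl⟩ hwv.ne⟩

/-- An arc with distinct end points in a maximal cyclic set meets that set elsewhere. -/
theorem IsMaximalCyclic.not_arc_inter_subset [T2Space X] {T A : Set X} {a b : X}
    (hT : IsMaximalCyclic T) (hA : IsArcBetween A a b) (ha : a ∈ T) (hb : b ∈ T) (hab : a ≠ b) :
    ¬ A ∩ T ⊆ {a, b} := by
  intro hAT
  have h := hT.2.2 _ (hT.2.1.union_arc hA ha hb hab hAT) subset_union_left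
  obtain ⟨c, hcA, hca, hcb⟩ := hA.exists_mem_ne hab
  have hcT : c ∈ T := h ▸ Or.inr hcA
  rcases hAT ⟨hcA, hcT⟩ with h | h
  exacts [hca h, hcb h]

end CyclicSets

theorem IsArcBetween.isPathConnected {X : Type*} [TopologicalSpace X] {A : Set X} {a b : X}
    (hA : IsArcBetween A a b) : IsPathConnected A := by
  obtain ⟨u, v, f, huv, hf, -, -, -, rfl⟩ := hA
  exact ((convex_Icc u v).isPathConnected (nonempty_Icc.2 huv)).image' hf

theorem IsPreconnected.inter_frontier_nonempty {X : Type*} [TopologicalSpace X] {A K : Set X}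
    {u v : X} (hA : IsPreconnected A) (hu : u ∈ A) (huK : u ∈ K) (hv : v ∈ A) (hvK : v ∉ K) :
    (A ∩ frontier K).Nonempty := by
  by_contra hne
  have hfr : ∀ x ∈ A, x ∈ closure K → x ∈ interior K := fun x hx hxc => by
    by_contra hxi
    exact hne ⟨x, hx, hxc, hxi⟩
  obtain ⟨x, -, hxi, hxc⟩ := hA (interior K) (closure K)ᶜ isOpen_interior
    isClosed_closure.isOpen_compl
    (fun x hx => (em (x ∈ closure K)).imp (hfr x hx) id)
    ⟨u, hu, hfr u hu (subset_closure huK)⟩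
    ⟨v, hv, fun h => hvK (interior_subset (hfr v hv h))⟩
  exact hxc (subset_closure (interior_subset hxi))

section Frontier

variable {X : Type*} [MetricSpace X] [LocallyPathConnectedSpace X]

/-- Frontier points of an open set `K` are limits of frontier points accessible from `K`. -/
theorem IsOpen.exists_joinedIn_insert {K N : Set X} {a : X} (hK : IsOpen K) (hN : IsOpen N)
    (ha : a ∈ N) (haK : a ∈ frontier K) :
    ∃ k ∈ K, ∃ w ∈ frontier K, w ∈ N ∧ JoinedIn (insert w K) k w := by
  obtain ⟨k, hkN, hkK⟩ : (pathComponentIn N a ∩ K).Nonempty :=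
    mem_closure_iff.1 (frontier_subset_closure haK) _ (hN.pathComponentIn a)
      (mem_pathComponentIn_self ha)
  obtain ⟨A, hAN, hA⟩ := (JoinedIn.symm hkN).exists_isArcBetween
  obtain ⟨w, hwK, A', hA'A, hA', hA'K⟩ := hA.exists_first_hit hK.isClosed_compl
    (hK.frontier_eq ▸ haK).2
  have hsub : A' ⊆ insert w K := fun x hx => by
    by_cases hxK : x ∈ K
    exacts [Or.inr hxK, Or.inl (hA'K ⟨hx, hxK⟩)]
  obtain ⟨x, hxA', hxK⟩ := hA'.isPathConnected.isConnected.isPreconnected.inter_frontier_nonempty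
    hA'.left_mem hkK hA'.right_mem hwK
  obtain rfl : x = w := hA'K ⟨hxA', (hK.frontier_eq ▸ hxK).2⟩
  refine ⟨k, hkK, x, hxK, hAN (hA'A hxA'), ?_⟩
  exact (hA'.isPathConnected.joinedIn _ hA'.left_mem _ hA'.right_mem).mono hsub

theorem IsMaximalCyclic.subsingleton_frontier {T K : Set X} (hT : IsMaximalCyclic T)
    (hK : IsOpen K) (hKc : IsPreconnected K) (hKT : Disjoint K T) (hfr : frontier K ⊆ T) :
    (frontier K).Subsingleton := by
  intro a ha b hb
  by_contra hab
  obtain ⟨U, V, hU, hV, haU, hbV, hUV⟩ := t2_separation hab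
  obtain ⟨k, hk, a', ha', ha'U, hja⟩ := hK.exists_joinedIn_insert hU haU ha
  obtain ⟨l, hl, b', hb', hb'V, hjb⟩ := hK.exists_joinedIn_insert hV hbV hb
  have hab' : a' ≠ b' := fun h => disjoint_left.1 hUV ha'U (h ▸ hb'V)
  have hkl : JoinedIn K k l :=
    (hK.isConnected_iff_isPathConnected.1 ⟨⟨k, hk⟩, hKc⟩).joinedIn k hk l hl
  have hj : JoinedIn (K ∪ {a', b'}) a' b' := by
    refine (hja.symm.mono ?_).trans ((hkl.mono subset_union_left).trans (hjb.mono ?_)) <;>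
      · rintro x (rfl | hx) <;> simp [*]
  obtain ⟨A, hAK, hA⟩ := hj.exists_isArcBetween
  refine hT.not_arc_inter_subset hA (hfr ha') (hfr hb') hab' ?_
  rintro x ⟨hxA, hxT⟩
  exact (hAK hxA).resolve_left fun h => disjoint_left.1 hKT h hxT

theorem frontier_connectedComponentIn_compl_subset {T : Set X} (hT : IsClosed T) (u : X) :
    frontier (connectedComponentIn Tᶜ u) ⊆ T := by
  intro x hx
  by_contra hxT
  rw [hT.isOpen_compl.connectedComponentIn.frontier_eq] at hx
  obtain ⟨y, hyx, hyu⟩ := mem_closure_iff.1 hx.1 _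
    (hT.isOpen_compl.connectedComponentIn (x := x)) (mem_connectedComponentIn hxT)
  exact hx.2 (connectedComponentIn_eq hyu ▸ connectedComponentIn_eq hyx ▸
    mem_connectedComponentIn hxT)

theorem IsMaximalCyclic.subsingleton_frontier_connectedComponentIn {T : Set X}
    (hT : IsMaximalCyclic T) (hTc : IsClosed T) (u : X) :
    (frontier (connectedComponentIn Tᶜ u)).Subsingleton :=
  hT.subsingleton_frontier hTc.isOpen_compl.connectedComponentIn isPreconnected_connectedComponentIn
    (disjoint_compl_left.mono_left (connectedComponentIn_subset _ _))
    (frontier_connectedComponentIn_compl_subset hTc u)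

end Frontier

section HausdorffLimit

variable {X ι : Type*} [PseudoEMetricSpace X] {l : Filter ι} {Cs : ι → Set X} {C : Set X}

theorem eventually_inter_nonempty_of_tendsto_hausdorffEDist
    (h : Tendsto (fun n => hausdorffEDist (Cs n) C) l (𝓝 0)) {U : Set X} {x : X} (hx : x ∈ C)
    (hU : U ∈ 𝓝 x) : ∀ᶠ n in l, (Cs n ∩ U).Nonempty := by
  obtain ⟨ε, hε, hεU⟩ := EMetric.mem_nhds_iff.1 hU
  filter_upwards [h.eventually (gt_mem_nhds hε)] with n hn
  rw [hausdorffEDist_comm] at hn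
  obtain ⟨y, hy, hxy⟩ := exists_edist_lt_of_hausdorffEDist_lt hx hn
  exact ⟨y, hy, hεU (by rwa [Metric.mem_eball, edist_comm])⟩

theorem eventually_subset_of_tendsto_hausdorffEDist
    (h : Tendsto (fun n => hausdorffEDist (Cs n) C) l (𝓝 0)) (hC : IsCompact C) {U : Set X}
    (hU : IsOpen U) (hCU : C ⊆ U) : ∀ᶠ n in l, Cs n ⊆ U := by
  obtain ⟨δ, hδ, hδU⟩ := hC.exists_thickening_subset_open hU hCU
  filter_upwards [h.eventually (gt_mem_nhds (ENNReal.ofReal_pos.2 hδ))] with n hn x hx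
  exact hδU ((infEDist_le_hausdorffEDist_of_mem hx).trans_lt hn)

end HausdorffLimit

/-- A compact Hausdorff limit of connected sets is connected. -/
theorem IsCompact.isConnected_of_tendsto_hausdorffEDist {X ι : Type*} [MetricSpace X]
    {l : Filter ι} [l.NeBot] {Cs : ι → Set X} {C : Set X} (hC : IsCompact C)
    (h : Tendsto (fun n => hausdorffEDist (Cs n) C) l (𝓝 0)) (hCs : ∀ n, IsConnected (Cs n)) :
    IsConnected C := by
  constructor
  · by_contra hne
    rw [not_nonempty_iff_eq_empty] at hne
    obtain ⟨n, hn⟩ :=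
      (eventually_subset_of_tendsto_hausdorffEDist h hC isOpen_empty hne.subset).exists
    exact (hCs n).nonempty.ne_empty (subset_empty_iff.1 hn)
  · rw [isPreconnected_closed_iff]
    rintro t t' ht ht' hCt ⟨x, hxC, hxt⟩ ⟨y, hyC, hyt'⟩
    by_contra hne
    have hdisj : Disjoint (C ∩ t) (C ∩ t') :=
      disjoint_left.2 fun z hz hz' => hne ⟨z, hz.1, hz.2, hz'.2⟩
    obtain ⟨U, V, hU, hV, htU, htV, hUV⟩ :=
      SeparatedNhds.of_isCompact_isCompact (hC.inter_right ht) (hC.inter_right ht') hdisj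
    have hCUV : C ⊆ U ∪ V := fun z hz =>
      (hCt hz).imp (fun h => htU ⟨hz, h⟩) fun h => htV ⟨hz, h⟩
    obtain ⟨n, hn, hnU, hnV⟩ :=
      ((eventually_subset_of_tendsto_hausdorffEDist h hC (hU.union hV) hCUV).and
        ((eventually_inter_nonempty_of_tendsto_hausdorffEDist h hxC
          (hU.mem_nhds (htU ⟨hxC, hxt⟩))).and
        (eventually_inter_nonempty_of_tendsto_hausdorffEDist h hyC
          (hV.mem_nhds (htV ⟨hyC, hyt'⟩))))).exists
    obtain ⟨z, -, hz⟩ := (hCs n).isPreconnected U V hU hV hn hnU hnV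
    exact disjoint_left.1 hUV hz.1 hz.2

/-- A connected set meeting two disjoint connected sets, both of which meet a closed maximal
cyclic set `T`, meets `T` in at least two points. -/
theorem IsMaximalCyclic.inter_nontrivial {X : Type*} [MetricSpace X] [LocallyPathConnectedSpace X]
    {T C U V : Set X} (hT : IsMaximalCyclic T) (hTc : IsClosed T) (hC : IsPreconnected C)
    (hU : IsPreconnected U) (hV : IsPreconnected V) (hUV : Disjoint U V)
    (hCU : (C ∩ U).Nonempty) (hCV : (C ∩ V).Nonempty) (hTU : (T ∩ U).Nonempty)
    (hTV : (T ∩ V).Nonempty) : (T ∩ C).Nontrivial := by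
  have gate : ∀ {W u}, IsPreconnected W → u ∈ W → (T ∩ W).Nonempty → u ∉ T →
      (W ∩ frontier (connectedComponentIn Tᶜ u)).Nonempty := by
    rintro W u hW hu ⟨x, hxT, hxW⟩ huT
    exact hW.inter_frontier_nonempty hu (mem_connectedComponentIn huT) hxW
      fun h => connectedComponentIn_subset _ _ h hxT
  have key : ∀ {U V u v}, IsPreconnected U → IsPreconnected V → Disjoint U V → u ∈ C → u ∈ U →
      v ∈ C → v ∈ V → (T ∩ U).Nonempty → (T ∩ V).Nonempty → (U ∩ (T ∩ C)).Nonempty := by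
    intro U V u v hU hV hUV huC hu hvC hv hTU hTV
    by_cases huT : u ∈ T
    · exact ⟨u, hu, huT, huC⟩
    obtain ⟨q, hqU, hq⟩ := gate hU hu hTU huT
    have hfr := hT.subsingleton_frontier_connectedComponentIn hTc u
    have hvu : v ∉ connectedComponentIn Tᶜ u := by
      intro h
      obtain ⟨p, hpV, hp⟩ := gate hV hv hTV (connectedComponentIn_subset _ _ h)
      rw [← connectedComponentIn_eq h] at hp
      exact disjoint_left.1 hUV hqU (hfr hp hq ▸ hpV)
    obtain ⟨p, hpC, hp⟩ :=
      hC.inter_frontier_nonempty huC (mem_connectedComponentIn huT) hvC hvu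
    obtain rfl := hfr hp hq
    exact ⟨p, hqU, frontier_connectedComponentIn_compl_subset hTc u hp, hpC⟩
  obtain ⟨u, huC, hu⟩ := hCU
  obtain ⟨v, hvC, hv⟩ := hCV
  obtain ⟨p, hpU, hp⟩ := key hU hV hUV huC hu hvC hv hTU hTV
  obtain ⟨q, hqV, hq⟩ := key hV hU hUV.symm hvC hv huC hu hTV hTU
  exact ⟨p, hp, q, hq, hUV.ne_of_mem hpU hqV⟩

/-- The property of meeting a closed maximal cyclic set in at most one point passes to Hausdorff
limits of connected sets. -/
theorem IsMaximalCyclic.inter_subsingleton_of_tendsto {X ι : Type*} [MetricSpace X]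
    [LocallyPathConnectedSpace X] {l : Filter ι} [l.NeBot] {Cs : ι → Set X} {T C : Set X}
    (hT : IsMaximalCyclic T) (hTc : IsClosed T) (hCs : ∀ n, IsPreconnected (Cs n))
    (hone : ∀ n, (T ∩ Cs n).Subsingleton)
    (h : Tendsto (fun n => hausdorffEDist (Cs n) C) l (𝓝 0)) : (T ∩ C).Subsingleton := by
  rintro x ⟨hxT, hxC⟩ y ⟨hyT, hyC⟩
  by_contra hxy
  obtain ⟨U, V, hU, hV, hxU, hyV, hUV⟩ := t2_separation hxy
  have hU' := hU.connectedComponentIn (x := x)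
  have hV' := hV.connectedComponentIn (x := y)
  have hxU' := mem_connectedComponentIn hxU
  have hyV' := mem_connectedComponentIn hyV
  obtain ⟨n, hnU, hnV⟩ :=
    ((eventually_inter_nonempty_of_tendsto_hausdorffEDist h hxC (hU'.mem_nhds hxU')).and
      (eventually_inter_nonempty_of_tendsto_hausdorffEDist h hyC (hV'.mem_nhds hyV'))).exists
  exact not_subsingleton_iff.2 (hT.inter_nontrivial hTc (hCs n) isPreconnected_connectedComponentIn
    isPreconnected_connectedComponentIn (hUV.mono (connectedComponentIn_subset _ _)
    (connectedComponentIn_subset _ _)) hnU hnV ⟨x, hxT, hxU'⟩ ⟨y, hyT, hyV'⟩) (hone n)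

/-! ## STATEMENT 10 -/

theorem stmt10 (X : Type) [MetricSpace X] (hX : IsPeano X)
    (hsurf : ∀ T : Set X, IsMaximalCyclic T → IsCompactSurface ↥T)
    (Cs : ℕ → Set X)
    (hCs : ∀ n, IsSubcontinuum (Cs n))
    (hone : ∀ n, ∀ T : Set X, IsMaximalCyclic T → (T ∩ Cs n).Subsingleton)
    (C : Set X) (hC : IsClosed C)
    (hconv : Filter.Tendsto (fun n => EMetric.hausdorffEdist (Cs n) C)
      Filter.atTop (nhds 0)) :
    IsSubcontinuum C ∧ ∀ T : Set X, IsMaximalCyclic T → (T ∩ C).Subsingleton := by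
  obtain ⟨_, _, _⟩ := hX
  have := LocallyConnectedSpace.locallyPathConnectedSpace X
  refine ⟨⟨hC.isCompact, hC.isCompact.isConnected_of_tendsto_hausdorffEDist hconv
    fun n => (hCs n).2⟩, fun T hT => ?_⟩
  have hTc : IsClosed T := (isCompact_iff_compactSpace.2 (hsurf T hT).1).isClosed
  exact hT.inter_subsingleton_of_tendsto hTc (fun n => (hCs n).2.isPreconnected)
    (fun n => hone n T hT) hconv
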